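/- arXiv:2401.15719 — 2 statements merged into one kernel-verified Lean document; each statement's English description precedes it below -/
import Mathlib

section
/- For every dimension d ≥ 1, every β ∈ (0,1), every L > 0 and every L-Lipschitz function g : ℝ^d → ℝ, there exists a twice continuously differentiable function f : ℝ^d → ℝ solving Stein's equation g(u) − E[g(Z)] = Δf(u) − uᵀ∇f(u) for all u ∈ ℝ^d, such that for all x, y ∈ ℝ^d: (i) ‖∇²f(x) − ∇²f(y)‖_op ≤ C̃₁(d,β) ‖x − y‖^β L, and (ii) |Δf(x) − Δf(y)| ≤ C̃₂(d,β) ‖x − y‖^β L, where C̃₁(d,β) = C₁(d) + 2/(1−β), C̃₂(d,β) = C₂(d) + 2d/(1−β), C₁(d) = 2^{3/2}(1 + 2d·Γ((1+d)/2))/(d·Γ(d/2)) and C₂(d) = 2√(2d/π). -/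
open MeasureTheory ProbabilityTheory
open scoped BigOperators NNReal ENNReal RealInnerProductSpace Matrix

noncomputable section

/-- The standard Gaussian measure `N(0, I_d)` on `ℝ^d`. -/
def stdGaussian (d : ℕ) : Measure (EuclideanSpace ℝ (Fin d)) :=
  (Measure.pi fun _ : Fin d => gaussianReal 0 1).map (EuclideanSpace.equiv (Fin d) ℝ).symm

/-- Multiplication of a vector in `ℝ^d` by a `d × d` matrix. -/
def mulVecE {d : ℕ} (M : Matrix (Fin d) (Fin d) ℝ) (x : EuclideanSpace ℝ (Fin d)) :
    EuclideanSpace ℝ (Fin d) :=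
  (EuclideanSpace.equiv (Fin d) ℝ).symm (M.mulVec (EuclideanSpace.equiv (Fin d) ℝ x))

/-- The Hessian of `f : ℝ^d → ℝ`, as a continuous linear map. -/
def hess {d : ℕ} (f : EuclideanSpace ℝ (Fin d) → ℝ) (x : EuclideanSpace ℝ (Fin d)) :
    EuclideanSpace ℝ (Fin d) →L[ℝ] EuclideanSpace ℝ (Fin d) :=
  fderiv ℝ (fun y => gradient f y) x

/-- The Laplacian of `f : ℝ^d → ℝ` (trace of the Hessian). -/
def lap {d : ℕ} (f : EuclideanSpace ℝ (Fin d) → ℝ) (x : EuclideanSpace ℝ (Fin d)) : ℝ :=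
  ∑ i : Fin d, ⟪hess f x (EuclideanSpace.single i 1), EuclideanSpace.single i 1⟫

/-- Mathlib's standard Gaussian measure on Euclidean space. -/
abbrev gam (d : ℕ) : Measure (EuclideanSpace ℝ (Fin d)) :=
  ProbabilityTheory.stdGaussian (EuclideanSpace ℝ (Fin d))

lemma stdGaussian_eq_gam (d : ℕ) : _root_.stdGaussian d = gam d := by
  rw [gam, ← map_pi_eq_stdGaussian]
  rfl

/-- The normalising constant of the Gaussian density. -/
def cst (d : ℕ) : ℝ := ((2 * Real.pi) ^ ((d : ℝ) / 2))⁻¹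

lemma cst_pos (d : ℕ) : 0 < cst d := by unfold cst; positivity

/-- The Gaussian density. -/
def phi {d : ℕ} (z : EuclideanSpace ℝ (Fin d)) : ℝ := cst d * Real.exp (-‖z‖ ^ 2 / 2)

lemma phi_pos {d : ℕ} (z : EuclideanSpace ℝ (Fin d)) : 0 < phi z :=
  mul_pos (cst_pos d) (Real.exp_pos _)

lemma continuous_phi {d : ℕ} : Continuous (phi (d := d)) := by unfold phi; fun_prop

lemma integrable_exp_neg {d : ℕ} {b : ℝ} (hb : 0 < b) :
    Integrable (fun z : EuclideanSpace ℝ (Fin d) => Real.exp (-b * ‖z‖ ^ 2)) := by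
  have h := GaussianFourier.integrable_cexp_neg_mul_sq_norm_add (V := EuclideanSpace ℝ (Fin d))
    (b := (b : ℂ)) (by simpa using hb) 0 0
  have h2 := h.norm
  refine h2.congr (Filter.Eventually.of_forall fun z => ?_)
  simp only [Complex.norm_exp]
  congr 1
  simp [← Complex.ofReal_pow]

lemma integrable_phi {d : ℕ} : Integrable (phi (d := d)) := by
  unfold phi
  refine ((integrable_exp_neg (d := d) (b := 1/2) (by norm_num)).const_mul (cst d)).congr
    (Filter.Eventually.of_forall fun z => ?_)
  simp only
  congr 2; ring

lemma integral_phi {d : ℕ} : ∫ z, phi (d := d) z = 1 := by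
  unfold phi
  rw [integral_const_mul]
  have := GaussianFourier.integral_rexp_neg_mul_sq_norm (V := EuclideanSpace ℝ (Fin d))
    (b := 1/2) (by norm_num)
  have h2 : ∀ z : EuclideanSpace ℝ (Fin d), Real.exp (-‖z‖ ^ 2 / 2) = Real.exp (-(1/2) * ‖z‖ ^ 2) := by
    intro z; congr 1; ring
  simp_rw [h2]
  rw [this, cst]
  have : Real.pi / (1/2) = 2 * Real.pi := by ring
  rw [this]
  simp only [finrank_euclideanSpace, Fintype.card_fin]
  exact inv_mul_cancel₀ (by positivity)

lemma gam_eq_withDensity (d : ℕ) :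
    gam d = volume.withDensity (fun z => ENNReal.ofReal (phi z)) := by
  have hm : Measurable (fun z : EuclideanSpace ℝ (Fin d) => ENNReal.ofReal (phi z)) :=
    (continuous_phi.measurable).ennreal_ofReal
  have : IsFiniteMeasure (volume.withDensity
      (fun z : EuclideanSpace ℝ (Fin d) => ENNReal.ofReal (phi z))) :=
    isFiniteMeasure_withDensity_ofReal integrable_phi.2
  apply Measure.ext_of_charFun
  ext t
  rw [gam, charFun_stdGaussian, charFun_apply,
    integral_withDensity_eq_integral_toReal_smul hm (by simp)]
  have h := GaussianFourier.integral_cexp_neg_mul_sq_norm_add (V := EuclideanSpace ℝ (Fin d))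
    (b := (1/2 : ℂ)) (by norm_num) Complex.I t
  have h2 : ∀ z : EuclideanSpace ℝ (Fin d),
      (ENNReal.ofReal (phi z)).toReal • Complex.exp (⟪z, t⟫ * Complex.I) =
      (cst d : ℂ) * Complex.exp (-(1/2) * ‖z‖ ^ 2 + Complex.I * ⟪t, z⟫) := by
    intro z
    rw [ENNReal.toReal_ofReal (phi_pos z).le, phi, Complex.real_smul, Complex.exp_add]
    push_cast
    rw [real_inner_comm, mul_comm Complex.I, mul_assoc]
    congr 3
    ring_nf
  simp_rw [h2]
  rw [integral_const_mul, h]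
  simp only [finrank_euclideanSpace, Fintype.card_fin]
  have h3 : ((Real.pi : ℂ) / (1/2)) ^ ((d : ℂ) / 2) = (((2 * Real.pi) ^ ((d : ℝ) / 2) : ℝ) : ℂ) := by
    rw [Complex.ofReal_cpow (by positivity)]
    push_cast
    congr 1; ring
  rw [h3, ← mul_assoc, ← Complex.ofReal_mul, cst, inv_mul_cancel₀ (by positivity)]
  simp
  congr 1; ring

lemma integral_gam {d : ℕ} {F : Type*} [NormedAddCommGroup F] [NormedSpace ℝ F]
    (h : EuclideanSpace ℝ (Fin d) → F) : ∫ z, h z ∂(gam d) = ∫ z, phi z • h z := by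
  have hm : Measurable (fun z : EuclideanSpace ℝ (Fin d) => ENNReal.ofReal (phi z)) :=
    (continuous_phi.measurable).ennreal_ofReal
  rw [gam_eq_withDensity, integral_withDensity_eq_integral_toReal_smul hm (by simp)]
  congr 1; ext z; rw [ENNReal.toReal_ofReal (phi_pos z).le]

lemma integrable_gam_iff {d : ℕ} {F : Type*} [NormedAddCommGroup F] [NormedSpace ℝ F]
    (h : EuclideanSpace ℝ (Fin d) → F) :
    Integrable h (gam d) ↔ Integrable (fun z => phi z • h z) := by
  have hm : Measurable (fun z : EuclideanSpace ℝ (Fin d) => ENNReal.ofReal (phi z)) :=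
    (continuous_phi.measurable).ennreal_ofReal
  rw [gam_eq_withDensity, integrable_withDensity_iff_integrable_smul' hm (by simp)]
  simp_rw [ENNReal.toReal_ofReal (phi_pos _).le]

lemma integrable_pow_gam (d n : ℕ) : Integrable (fun z => (1 + ‖z‖) ^ n) (gam d) := by
  have h0 : MemLp (fun z : EuclideanSpace ℝ (Fin d) => ‖z‖) n (gam d) :=
    (IsGaussian.memLp_id (gam d) n (by simp)).norm
  have h1 : MemLp (fun _ : EuclideanSpace ℝ (Fin d) => (1 : ℝ)) n (gam d) := memLp_const 1
  have h : MemLp (fun z : EuclideanSpace ℝ (Fin d) => 1 + ‖z‖) n (gam d) := h1.add h0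
  have := h.integrable_norm_pow'
  refine this.congr (Filter.Eventually.of_forall fun z => ?_)
  simp only
  rw [Real.norm_of_nonneg (by positivity)]

lemma integrable_gam_of_le {d n : ℕ} {F : Type*} [NormedAddCommGroup F]
    {h : EuclideanSpace ℝ (Fin d) → F} (hc : AEStronglyMeasurable h (gam d)) (C : ℝ)
    (hb : ∀ z, ‖h z‖ ≤ C * (1 + ‖z‖) ^ n) : Integrable h (gam d) :=
  ((integrable_pow_gam d n).const_mul C).mono' hc (Filter.Eventually.of_forall hb)

lemma integrable_dom (d n : ℕ) : Integrable
    (fun z : EuclideanSpace ℝ (Fin d) => (1 + ‖z‖) ^ n * Real.exp (-‖z‖ ^ 2 / 4)) := by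
  have h := (integrable_gam_iff _).1 (integrable_pow_gam d n)
  have hr : (Real.sqrt 2)⁻¹ ≠ 0 := by positivity
  have h2 := (h.comp_smul hr).const_mul ((cst d)⁻¹ * (Real.sqrt 2) ^ n)
  refine h2.mono' (by fun_prop) (Filter.Eventually.of_forall fun z => ?_)
  rw [Real.norm_of_nonneg (by positivity)]
  have e1 : ‖(Real.sqrt 2)⁻¹ • z‖ = (Real.sqrt 2)⁻¹ * ‖z‖ := by
    rw [norm_smul, Real.norm_of_nonneg (by positivity)]
  have hs : Real.sqrt 2 ^ 2 = 2 := Real.sq_sqrt (by norm_num)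
  have hs1 : 1 ≤ Real.sqrt 2 := by rw [Real.one_le_sqrt]; norm_num
  have e2 : -((Real.sqrt 2)⁻¹ * ‖z‖) ^ 2 / 2 = -‖z‖ ^ 2 / 4 := by
    rw [mul_pow, inv_pow, hs]; ring
  simp only [phi, e1, e2, smul_eq_mul]
  have e3 : (cst d)⁻¹ * Real.sqrt 2 ^ n * (cst d * Real.exp (-‖z‖ ^ 2 / 4) *
      (1 + (Real.sqrt 2)⁻¹ * ‖z‖) ^ n) =
      (Real.sqrt 2 + ‖z‖) ^ n * Real.exp (-‖z‖ ^ 2 / 4) := by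
    have : Real.sqrt 2 + ‖z‖ = Real.sqrt 2 * (1 + (Real.sqrt 2)⁻¹ * ‖z‖) := by
      field_simp
    rw [this, mul_pow]
    have := (cst_pos d).ne'
    field_simp
  rw [e3]
  gcongr

lemma integral_inner_sq {d : ℕ} (u : EuclideanSpace ℝ (Fin d)) :
    ∫ z, ⟪z, u⟫ ^ 2 ∂(gam d) = ‖u‖ ^ 2 := by
  have h := variance_dual_stdGaussian (innerSL ℝ u)
  rw [variance_of_integral_eq_zero (by fun_prop) (integral_strongDual_stdGaussian _)] at h
  simp only [innerSL_apply_norm, innerSL_apply_apply] at h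
  rw [← h]
  simp_rw [real_inner_comm]

lemma integrable_inner_mul {d : ℕ} (u v : EuclideanSpace ℝ (Fin d)) :
    Integrable (fun z => ⟪z, u⟫ * ⟪z, v⟫) (gam d) := by
  refine integrable_gam_of_le (n := 2) (by fun_prop) (‖u‖ * ‖v‖) fun z => ?_
  rw [norm_mul]
  have h1 := norm_inner_le_norm (𝕜 := ℝ) z u
  have h2 := norm_inner_le_norm (𝕜 := ℝ) z v
  calc _ ≤ (‖z‖ * ‖u‖) * (‖z‖ * ‖v‖) := by gcongr
    _ = ‖u‖ * ‖v‖ * ‖z‖ ^ 2 := by ring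
    _ ≤ _ := by gcongr; linarith

lemma integral_abs_inner_mul {d : ℕ} (u v : EuclideanSpace ℝ (Fin d)) :
    ∫ z, |⟪z, u⟫ * ⟪z, v⟫| ∂(gam d) ≤ ‖u‖ * ‖v‖ := by
  by_cases hu : u = 0
  · simp [hu]
  by_cases hv : v = 0
  · simp [hv]
  have hu' : 0 < ‖u‖ := norm_pos_iff.2 hu
  have hv' : 0 < ‖v‖ := norm_pos_iff.2 hv
  have i1 : Integrable (fun z => ⟪z, u⟫ ^ 2) (gam d) := by
    simpa [sq] using integrable_inner_mul u u
  have i2 : Integrable (fun z => ⟪z, v⟫ ^ 2) (gam d) := by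
    simpa [sq] using integrable_inner_mul v v
  calc _ ≤ ∫ z, (‖v‖ / (2 * ‖u‖) * ⟪z, u⟫ ^ 2 + ‖u‖ / (2 * ‖v‖) * ⟪z, v⟫ ^ 2) ∂(gam d) := by
        refine integral_mono (integrable_inner_mul u v).abs
          ((i1.const_mul _).add (i2.const_mul _)) fun z => ?_
        simp only
        set a := ⟪z, u⟫
        set b := ⟪z, v⟫
        have e : ‖v‖ / (2 * ‖u‖) * a ^ 2 + ‖u‖ / (2 * ‖v‖) * b ^ 2 =
          (‖v‖ ^ 2 * a ^ 2 + ‖u‖ ^ 2 * b ^ 2) / (2 * ‖u‖ * ‖v‖) := by field_simp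
        rw [e, le_div_iff₀ (by positivity), abs_mul, ← sq_abs a, ← sq_abs b]
        nlinarith [sq_nonneg (‖v‖ * |a| - ‖u‖ * |b|)]
    _ = _ := by
        rw [integral_add (i1.const_mul _) (i2.const_mul _), integral_const_mul, integral_const_mul,
          integral_inner_sq, integral_inner_sq]
        field_simp; ring

lemma integral_abs_inner {d : ℕ} (u : EuclideanSpace ℝ (Fin d)) :
    ∫ z, |⟪z, u⟫| ∂(gam d) ≤ ‖u‖ := by
  by_cases hu : u = 0
  · simp [hu]
  have hu' : 0 < ‖u‖ := norm_pos_iff.2 hu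
  have i1 : Integrable (fun z => ⟪z, u⟫ ^ 2) (gam d) := by
    simpa [sq] using integrable_inner_mul u u
  have i0 : Integrable (fun z => ⟪z, u⟫) (gam d) := by
    refine integrable_gam_of_le (n := 1) (by fun_prop) ‖u‖ fun z => ?_
    have h1 := norm_inner_le_norm (𝕜 := ℝ) z u
    nlinarith
  calc _ ≤ ∫ z, ((2 * ‖u‖)⁻¹ * ⟪z, u⟫ ^ 2 + ‖u‖ / 2) ∂(gam d) := by
        refine integral_mono i0.abs ((i1.const_mul _).add (integrable_const _)) fun z => ?_
        simp only
        set a := ⟪z, u⟫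
        have e : (2 * ‖u‖)⁻¹ * a ^ 2 + ‖u‖ / 2 = (a ^ 2 + ‖u‖ ^ 2) / (2 * ‖u‖) := by field_simp
        rw [e, le_div_iff₀ (by positivity), ← sq_abs a]
        nlinarith [sq_nonneg (|a| - ‖u‖)]
    _ = _ := by
        rw [integral_add (i1.const_mul _) (integrable_const _), integral_const_mul,
          integral_inner_sq]
        simp
        field_simp; ring

lemma hfd_congr {E F : Type*} [NormedAddCommGroup E] [NormedSpace ℝ E] [NormedAddCommGroup F]
    [NormedSpace ℝ F] {f g : E → F} {f' g' : E →L[ℝ] F} {x : E} (h : HasFDerivAt f f' x)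
    (h1 : ∀ y, g y = f y) (h2 : ∀ v, g' v = f' v) : HasFDerivAt g g' x := by
  have e1 : g = f := funext h1
  have e2 : g' = f' := ContinuousLinearMap.ext h2
  rw [e1, e2]; exact h

lemma exp_shift_le {E : Type*} [NormedAddCommGroup E] (z h : E) :
    Real.exp (-‖z - h‖ ^ 2 / 2) ≤ Real.exp (‖h‖ ^ 2 / 2) * Real.exp (-‖z‖ ^ 2 / 4) := by
  rw [← Real.exp_add]
  apply Real.exp_le_exp.2
  have h1 : ‖z‖ ≤ ‖z - h‖ + ‖h‖ := by simpa using norm_add_le (z - h) h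
  have h2 : ‖z‖ ^ 2 ≤ (‖z - h‖ + ‖h‖) ^ 2 := by gcongr
  nlinarith [sq_nonneg (‖z - h‖ - ‖h‖)]

lemma hasFDerivAt_translate {d : ℕ} {F : Type*} [NormedAddCommGroup F] [NormedSpace ℝ F]
    [FiniteDimensional ℝ F]
    {k : EuclideanSpace ℝ (Fin d) → ℝ} (hk : Continuous k) {K : ℝ}
    (hK : ∀ z, |k z| ≤ K * (1 + ‖z‖))
    {ψ : EuclideanSpace ℝ (Fin d) → F} {ψ' : EuclideanSpace ℝ (Fin d) → EuclideanSpace ℝ (Fin d) →L[ℝ] F}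
    (hψ : ∀ z, HasFDerivAt ψ (ψ' z) z) (hc : Continuous ψ') {C : ℝ} (hC0 : 0 ≤ C)
    (hC : ∀ z, ‖ψ z‖ ≤ C * (1 + ‖z‖) ^ 2 * Real.exp (-‖z‖ ^ 2 / 2))
    (hC' : ∀ z, ‖ψ' z‖ ≤ C * (1 + ‖z‖) ^ 2 * Real.exp (-‖z‖ ^ 2 / 2)) :
    HasFDerivAt (fun h => ∫ z, k (z + h) • ψ z) (-∫ z, k z • ψ' z) 0 := by
  have hψc : Continuous ψ := continuous_iff_continuousAt.2 fun z => (hψ z).continuousAt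
  have hK0 : 0 ≤ K := by have := hK 0; simp at this; exact (abs_nonneg _).trans this
  have e : (fun h => ∫ z, k (z + h) • ψ z) = fun h => ∫ z, k z • ψ (z - h) := by
    ext h
    rw [← integral_sub_right_eq_self (fun z => k (z + h) • ψ z) h]
    simp
  have e2 : (-∫ z, k z • ψ' z) = ∫ z, k z • -(ψ' (z - 0)) := by
    simp [integral_neg]
  rw [e, e2]
  have key : ∀ z h : EuclideanSpace ℝ (Fin d), ‖h‖ < 1 →
      C * (1 + ‖z - h‖) ^ 2 * Real.exp (-‖z - h‖ ^ 2 / 2) ≤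
      (C * 4 * Real.exp (1 / 2)) * ((1 + ‖z‖) ^ 2 * Real.exp (-‖z‖ ^ 2 / 4)) := by
    intro z h hh
    have a1 : 1 + ‖z - h‖ ≤ 2 * (1 + ‖z‖) := by
      have := norm_sub_le z h
      have := norm_nonneg z
      linarith
    have a2 : Real.exp (-‖z - h‖ ^ 2 / 2) ≤ Real.exp (1 / 2) * Real.exp (-‖z‖ ^ 2 / 4) := by
      refine (exp_shift_le z h).trans ?_
      gcongr
      nlinarith [norm_nonneg h]
    calc _ ≤ C * (2 * (1 + ‖z‖)) ^ 2 * (Real.exp (1 / 2) * Real.exp (-‖z‖ ^ 2 / 4)) := by gcongr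
      _ = _ := by ring
  have key2 : ∀ (A : ℝ) (z h : EuclideanSpace ℝ (Fin d)), ‖h‖ < 1 →
      A ≤ C * (1 + ‖z - h‖) ^ 2 * Real.exp (-‖z - h‖ ^ 2 / 2) → 0 ≤ A →
      |k z| * A ≤ K * (C * 4 * Real.exp (1 / 2)) * ((1 + ‖z‖) ^ 3 * Real.exp (-‖z‖ ^ 2 / 4)) := by
    intro A z h hh hA hA0
    calc _ ≤ (K * (1 + ‖z‖)) * ((C * 4 * Real.exp (1 / 2)) * ((1 + ‖z‖) ^ 2 * Real.exp (-‖z‖ ^ 2 / 4))) := by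
          gcongr
          · exact hK z
          · exact hA.trans (key z h hh)
      _ = _ := by ring
  have hint := (integrable_dom d 3).const_mul (K * (C * 4 * Real.exp (1 / 2)))
  refine hasFDerivAt_integral_of_dominated_of_fderiv_le (s := Metric.ball 0 1)
    (F' := fun h z => k z • -(ψ' (z - h)))
    (bound := fun z => K * (C * 4 * Real.exp (1 / 2)) * ((1 + ‖z‖) ^ 3 * Real.exp (-‖z‖ ^ 2 / 4)))
    (Metric.ball_mem_nhds _ one_pos) ?_ ?_ ?_ ?_ hint ?_
  · exact Filter.Eventually.of_forall fun h => by
      apply Continuous.aestronglyMeasurable; fun_prop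
  · refine hint.mono' (by apply Continuous.aestronglyMeasurable; fun_prop)
      (Filter.Eventually.of_forall fun z => ?_)
    rw [norm_smul]
    exact key2 _ z 0 (by simp) (hC _) (norm_nonneg _)
  · apply Continuous.aestronglyMeasurable; fun_prop
  · refine Filter.Eventually.of_forall fun z h hh => ?_
    rw [norm_smul, norm_neg]
    exact key2 _ z h (by simpa using hh) (hC' _) (norm_nonneg _)
  · refine Filter.Eventually.of_forall fun z h hh => ?_
    have h1 : HasFDerivAt (fun h => z - h) (-ContinuousLinearMap.id ℝ (EuclideanSpace ℝ (Fin d))) h := by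
      simpa using (hasFDerivAt_id (𝕜 := ℝ) h).const_sub z
    have h2 := ((hψ (z - h)).comp h h1).const_smul (k z)
    refine hfd_congr h2 (fun y => rfl) fun v => ?_
    simp

/-- The standard deviation `√(1 - s²)`. -/
def sg (s : ℝ) : ℝ := Real.sqrt (1 - s ^ 2)

lemma sg_pos {s : ℝ} (h : s ∈ Set.Ioo (0 : ℝ) 1) : 0 < sg s := by
  apply Real.sqrt_pos.2; nlinarith [h.1, h.2]

lemma sg_sq {s : ℝ} (h : s ∈ Set.Ioo (0 : ℝ) 1) : sg s ^ 2 = 1 - s ^ 2 := by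
  apply Real.sq_sqrt; nlinarith [h.1, h.2]

lemma sg_nonneg (s : ℝ) : 0 ≤ sg s := Real.sqrt_nonneg _

lemma sg_le_one (s : ℝ) : sg s ≤ 1 := by
  apply Real.sqrt_le_one.2; nlinarith [sq_nonneg s]

lemma continuous_sg : Continuous sg := by unfold sg; fun_prop

/-- `z ⊗ z`. -/
def ten {d : ℕ} (z : EuclideanSpace ℝ (Fin d)) :
    EuclideanSpace ℝ (Fin d) →L[ℝ] EuclideanSpace ℝ (Fin d) :=
  (innerSL ℝ z).smulRight z

lemma ten_apply {d : ℕ} (z v : EuclideanSpace ℝ (Fin d)) : ten z v = ⟪z, v⟫ • z := by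
  simp [ten]

lemma continuous_ten {d : ℕ} : Continuous (ten (d := d)) := by
  have : ten (d := d) = fun z => ContinuousLinearMap.smulRightL ℝ _ _ (innerSL ℝ z) z := by
    ext z v; simp [ten]
  rw [this]
  fun_prop

lemma norm_ten {d : ℕ} (z : EuclideanSpace ℝ (Fin d)) : ‖ten z‖ = ‖z‖ ^ 2 := by
  simp [ten, ContinuousLinearMap.norm_smulRight_apply, sq]

/-- The Ornstein-Uhlenbeck average. -/
def Gs {d : ℕ} (g : EuclideanSpace ℝ (Fin d) → ℝ) (s : ℝ) (x : EuclideanSpace ℝ (Fin d)) : ℝ :=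
  ∫ z, g (s • x + sg s • z) ∂(gam d)

/-- Its gradient. -/
def ms {d : ℕ} (g : EuclideanSpace ℝ (Fin d) → ℝ) (s : ℝ) (x : EuclideanSpace ℝ (Fin d)) :
    EuclideanSpace ℝ (Fin d) :=
  (s / sg s) • ∫ z, g (s • x + sg s • z) • z ∂(gam d)

/-- Its Hessian. -/
def Hs {d : ℕ} (g : EuclideanSpace ℝ (Fin d) → ℝ) (s : ℝ) (x : EuclideanSpace ℝ (Fin d)) :
    EuclideanSpace ℝ (Fin d) →L[ℝ] EuclideanSpace ℝ (Fin d) :=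
  (s / sg s) ^ 2 • ∫ z, g (s • x + sg s • z) • (ten z - ContinuousLinearMap.id ℝ _) ∂(gam d)

lemma continuous_of_lip {d : ℕ} {g : EuclideanSpace ℝ (Fin d) → ℝ} {L : ℝ}
    (hg : ∀ x y, |g x - g y| ≤ L * ‖x - y‖) : Continuous g := by
  have : LipschitzWith (Real.toNNReal L) g := by
    apply LipschitzWith.of_dist_le_mul
    intro x y
    rw [Real.dist_eq, dist_eq_norm]
    refine (hg x y).trans ?_
    gcongr
    exact Real.le_coe_toNNReal L
  exact this.continuous

lemma growth {d : ℕ} {g : EuclideanSpace ℝ (Fin d) → ℝ} {L : ℝ} (hL : 0 ≤ L)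
    (hg : ∀ x y, |g x - g y| ≤ L * ‖x - y‖) (a z : EuclideanSpace ℝ (Fin d)) (b : ℝ) :
    |g (a + b • z)| ≤ (|g a| + L * |b|) * (1 + ‖z‖) := by
  have h1 := hg (a + b • z) a
  rw [add_sub_cancel_left, norm_smul, Real.norm_eq_abs] at h1
  have h2 := abs_sub_abs_le_abs_sub (g (a + b • z)) (g a)
  have h3 : 0 ≤ |g a| * ‖z‖ := by positivity
  have h4 : 0 ≤ L * |b| := by positivity
  nlinarith

lemma hasFDerivAt_phi {d : ℕ} (z : EuclideanSpace ℝ (Fin d)) :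
    HasFDerivAt (phi (d := d)) (-(phi z • innerSL ℝ z)) z := by
  have h := (((hasStrictFDerivAt_norm_sq z).hasFDerivAt.neg.mul_const (1/2 : ℝ)).exp).const_mul (cst d)
  have e : phi (d := d) = fun y => cst d * Real.exp (-‖y‖ ^ 2 * (1/2)) := by
    ext y; simp only [phi]; congr 2; ring
  rw [e]
  refine hfd_congr h (fun y => rfl) fun v => ?_
  simp
  ring

lemma hasFDerivAt_phi_smul {d : ℕ} (z : EuclideanSpace ℝ (Fin d)) :
    HasFDerivAt (fun z : EuclideanSpace ℝ (Fin d) => phi z • z)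
      (-(phi z • (ten z - ContinuousLinearMap.id ℝ _))) z := by
  have h := (hasFDerivAt_phi z).smul (hasFDerivAt_id (𝕜 := ℝ) z)
  refine hfd_congr h (fun y => rfl) fun v => ?_
  simp [ten_apply, smul_smul, sub_eq_add_neg]

lemma hasFDerivAt_Gs {d : ℕ} {g : EuclideanSpace ℝ (Fin d) → ℝ} {L : ℝ} (hL : 0 ≤ L)
    (hg : ∀ x y, |g x - g y| ≤ L * ‖x - y‖) {s : ℝ} (hs : s ∈ Set.Ioo (0 : ℝ) 1)
    (x : EuclideanSpace ℝ (Fin d)) : HasFDerivAt (Gs g s) (innerSL ℝ (ms g s x)) x := by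
  have hgc := continuous_of_lip hg
  have hσ := sg_pos hs
  have h := hasFDerivAt_translate (k := fun z => g (s • x + sg s • z)) (by fun_prop)
    (fun z => growth hL hg (s • x) z (sg s)) hasFDerivAt_phi
    (by have := continuous_phi (d := d); fun_prop) (C := cst d) (cst_pos d).le
    (by
      intro z
      rw [Real.norm_of_nonneg (phi_pos z).le, phi]
      have : 1 ≤ (1 + ‖z‖) ^ 2 := one_le_pow₀ (by linarith [norm_nonneg z])
      have h0 := cst_pos d
      gcongr
      nlinarith)
    (by
      intro z
      rw [norm_neg, norm_smul, innerSL_apply_norm, Real.norm_of_nonneg (phi_pos z).le, phi]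
      have : ‖z‖ ≤ (1 + ‖z‖) ^ 2 := by nlinarith [norm_nonneg z]
      have h0 := cst_pos d
      calc _ = cst d * ‖z‖ * Real.exp (-‖z‖ ^ 2 / 2) := by ring
        _ ≤ _ := by gcongr)
  have haff : HasFDerivAt (fun y => (s / sg s) • (y - x))
      ((s / sg s) • ContinuousLinearMap.id ℝ (EuclideanSpace ℝ (Fin d))) x :=
    ((hasFDerivAt_id (𝕜 := ℝ) x).sub_const x).const_smul (s / sg s)
  have h' := h
  rw [show (0 : EuclideanSpace ℝ (Fin d)) = (s / sg s) • (x - x) by simp] at h'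
  have h2 := HasFDerivAt.comp x h' haff
  refine hfd_congr h2 (fun y => ?_) (fun v => ?_)
  · simp only [Gs, integral_gam, Function.comp]
    congr 1; ext z
    rw [smul_eq_mul, smul_eq_mul, mul_comm]
    congr 2
    rw [smul_add, smul_smul, mul_div_cancel₀ _ hσ.ne']
    module
  · have hI : Integrable (fun z => phi z • g (s • x + sg s • z) • z) := by
      rw [← integrable_gam_iff]
      refine integrable_gam_of_le (n := 2) (by apply Continuous.aestronglyMeasurable; fun_prop) (|g (s • x)| + L * |sg s|) fun z => ?_
      rw [norm_smul]
      have := growth hL hg (s • x) z (sg s)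
      have h0 : 0 ≤ |g (s • x)| + L * |sg s| := by positivity
      calc _ ≤ ((|g (s • x)| + L * |sg s|) * (1 + ‖z‖)) * (1 + ‖z‖) := by
            gcongr
            · exact this
            · linarith
        _ = _ := by ring
    simp only [ms, integral_gam]
    rw [map_smul, ← (innerSL ℝ).integral_comp_comm hI]
    simp only [map_smul, smul_neg, integral_neg, neg_neg]
    simp [smul_smul, mul_comm]
    
lemma hasFDerivAt_ms {d : ℕ} {g : EuclideanSpace ℝ (Fin d) → ℝ} {L : ℝ} (hL : 0 ≤ L)
    (hg : ∀ x y, |g x - g y| ≤ L * ‖x - y‖) {s : ℝ} (hs : s ∈ Set.Ioo (0 : ℝ) 1)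
    (x : EuclideanSpace ℝ (Fin d)) : HasFDerivAt (ms g s) (Hs g s x) x := by
  have hgc := continuous_of_lip hg
  have hσ := sg_pos hs
  have h := hasFDerivAt_translate (k := fun z => g (s • x + sg s • z)) (by fun_prop)
    (fun z => growth hL hg (s • x) z (sg s)) hasFDerivAt_phi_smul
    (by have := continuous_phi (d := d); have := continuous_ten (d := d); fun_prop)
    (C := cst d) (cst_pos d).le
    (by
      intro z
      rw [norm_smul, Real.norm_of_nonneg (phi_pos z).le, phi]
      have : ‖z‖ ≤ (1 + ‖z‖) ^ 2 := by nlinarith [norm_nonneg z]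
      have h0 := cst_pos d
      calc _ = cst d * ‖z‖ * Real.exp (-‖z‖ ^ 2 / 2) := by ring
        _ ≤ _ := by gcongr)
    (by
      intro z
      rw [norm_neg, norm_smul, Real.norm_of_nonneg (phi_pos z).le, phi]
      have : ‖ten z - ContinuousLinearMap.id ℝ _‖ ≤ (1 + ‖z‖) ^ 2 := by
        refine (norm_sub_le _ _).trans ?_
        rw [norm_ten]
        have := ContinuousLinearMap.norm_id_le (𝕜 := ℝ) (E := EuclideanSpace ℝ (Fin d))
        nlinarith [norm_nonneg z]
      have h0 := cst_pos d
      calc _ = cst d * ‖ten z - ContinuousLinearMap.id ℝ _‖ * Real.exp (-‖z‖ ^ 2 / 2) := by ring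
        _ ≤ _ := by gcongr)
  have haff : HasFDerivAt (fun y => (s / sg s) • (y - x))
      ((s / sg s) • ContinuousLinearMap.id ℝ (EuclideanSpace ℝ (Fin d))) x :=
    ((hasFDerivAt_id (𝕜 := ℝ) x).sub_const x).const_smul (s / sg s)
  have h' := h
  rw [show (0 : EuclideanSpace ℝ (Fin d)) = (s / sg s) • (x - x) by simp] at h'
  have h2 := (HasFDerivAt.comp x h' haff).const_smul (s / sg s)
  refine hfd_congr h2 (fun y => ?_) (fun v => ?_)
  · simp only [ms, integral_gam, Pi.smul_apply, Function.comp]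
    congr 2; ext1 z
    rw [smul_comm]
    congr 2
    rw [smul_add, smul_smul, mul_div_cancel₀ _ hσ.ne']
    module
  · simp only [Hs, integral_gam, smul_neg, integral_neg, neg_neg]
    simp only [sq, mul_smul, smul_apply, ContinuousLinearMap.comp_apply,
      ContinuousLinearMap.id_apply, map_smul]
    simp_rw [smul_comm (phi _)]

lemma int_g {d : ℕ} {g : EuclideanSpace ℝ (Fin d) → ℝ} {L : ℝ} (hL : 0 ≤ L)
    (hg : ∀ x y, |g x - g y| ≤ L * ‖x - y‖) {F : Type*} [NormedAddCommGroup F] [NormedSpace ℝ F]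
    [FiniteDimensional ℝ F]
    {q : EuclideanSpace ℝ (Fin d) → F} (hq : Continuous q) {C : ℝ}
    (hC : ∀ z, ‖q z‖ ≤ C * (1 + ‖z‖) ^ 2) (a : EuclideanSpace ℝ (Fin d)) (b : ℝ) :
    Integrable (fun z => g (a + b • z) • q z) (gam d) := by
  have hgc := continuous_of_lip hg
  refine integrable_gam_of_le (n := 3) (by apply Continuous.aestronglyMeasurable; fun_prop)
    ((|g a| + L * |b|) * C) fun z => ?_
  rw [norm_smul]
  have := growth hL hg a z b
  have h0 : 0 ≤ |g a| + L * |b| := by positivity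
  calc _ ≤ ((|g a| + L * |b|) * (1 + ‖z‖)) * (C * (1 + ‖z‖) ^ 2) := by
        gcongr
        · exact this
        · exact hC z
    _ = _ := by ring

lemma norm_id_bound {d : ℕ} (z : EuclideanSpace ℝ (Fin d)) : ‖z‖ ≤ 1 * (1 + ‖z‖) ^ 2 := by
  nlinarith [norm_nonneg z]

lemma norm_ten_sub_id {d : ℕ} (z : EuclideanSpace ℝ (Fin d)) :
    ‖ten z - ContinuousLinearMap.id ℝ _‖ ≤ 1 * (1 + ‖z‖) ^ 2 := by
  refine (norm_sub_le _ _).trans ?_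
  rw [norm_ten]
  have := ContinuousLinearMap.norm_id_le (𝕜 := ℝ) (E := EuclideanSpace ℝ (Fin d))
  nlinarith [norm_nonneg z]

/-- The trace, as a continuous linear map. -/
def trL (d : ℕ) : (EuclideanSpace ℝ (Fin d) →L[ℝ] EuclideanSpace ℝ (Fin d)) →L[ℝ] ℝ :=
  ∑ i : Fin d, (innerSL ℝ (EuclideanSpace.single i (1 : ℝ))) ∘L
    (ContinuousLinearMap.apply ℝ (EuclideanSpace ℝ (Fin d)) (EuclideanSpace.single i (1 : ℝ)))

lemma trL_apply {d : ℕ} (A : EuclideanSpace ℝ (Fin d) →L[ℝ] EuclideanSpace ℝ (Fin d)) :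
    trL d A = ∑ i : Fin d, ⟪A (EuclideanSpace.single i 1), EuclideanSpace.single i 1⟫ := by
  simp [trL, real_inner_comm]

lemma trL_ten {d : ℕ} (z : EuclideanSpace ℝ (Fin d)) :
    trL d (ten z - ContinuousLinearMap.id ℝ _) = ‖z‖ ^ 2 - d := by
  rw [trL_apply, EuclideanSpace.norm_sq_eq]
  simp [ten_apply, inner_sub_left, EuclideanSpace.inner_single_right,
    EuclideanSpace.inner_single_left, sq]

lemma trL_Hs {d : ℕ} {g : EuclideanSpace ℝ (Fin d) → ℝ} {L : ℝ} (hL : 0 ≤ L)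
    (hg : ∀ x y, |g x - g y| ≤ L * ‖x - y‖) (s : ℝ) (x : EuclideanSpace ℝ (Fin d)) :
    trL d (Hs g s x) = (s / sg s) ^ 2 * ∫ z, g (s • x + sg s • z) * (‖z‖ ^ 2 - d) ∂(gam d) := by
  have hc : Continuous fun z : EuclideanSpace ℝ (Fin d) => ten z - ContinuousLinearMap.id ℝ _ :=
    continuous_ten.sub continuous_const
  rw [Hs, map_smul, ← (trL d).integral_comp_comm (int_g hL hg hc norm_ten_sub_id _ _)]
  simp_rw [map_smul, trL_ten]
  rfl

lemma inner_ms {d : ℕ} {g : EuclideanSpace ℝ (Fin d) → ℝ} {L : ℝ} (hL : 0 ≤ L)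
    (hg : ∀ x y, |g x - g y| ≤ L * ‖x - y‖) (s : ℝ) (x u : EuclideanSpace ℝ (Fin d)) :
    ⟪u, ms g s x⟫ = (s / sg s) * ∫ z, g (s • x + sg s • z) * ⟪u, z⟫ ∂(gam d) := by
  have h := (innerSL ℝ u).integral_comp_comm
    (int_g hL hg (q := fun z => z) continuous_id norm_id_bound (s • x) (sg s))
  simp only [innerSL_apply_apply, inner_smul_right] at h
  rw [ms, inner_smul_right, ← h]

/-- The transition density. -/
def PP {d : ℕ} (x : EuclideanSpace ℝ (Fin d)) (s : ℝ) (w : EuclideanSpace ℝ (Fin d)) : ℝ :=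
  cst d * (1 - s ^ 2) ^ (-((d : ℝ) / 2)) * Real.exp (-(‖w - s • x‖ ^ 2) / (2 * (1 - s ^ 2)))

/-- The logarithmic derivative of the transition density. -/
def QQ {d : ℕ} (x : EuclideanSpace ℝ (Fin d)) (s : ℝ) (w : EuclideanSpace ℝ (Fin d)) : ℝ :=
  d * s / (1 - s ^ 2) + ⟪w - s • x, x⟫ / (1 - s ^ 2) - s * ‖w - s • x‖ ^ 2 / (1 - s ^ 2) ^ 2

lemma cov {d : ℕ} (g q : EuclideanSpace ℝ (Fin d) → ℝ) {s : ℝ} (hs : s ∈ Set.Ioo (0 : ℝ) 1)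
    (x : EuclideanSpace ℝ (Fin d)) :
    ∫ z, g (s • x + sg s • z) * q z ∂(gam d) =
      ∫ w, g w * (PP x s w * q ((sg s)⁻¹ • (w - s • x))) := by
  have hσ := sg_pos hs
  rw [integral_gam]
  set h : EuclideanSpace ℝ (Fin d) → ℝ :=
    fun y => phi ((sg s)⁻¹ • y) * (g (s • x + y) * q ((sg s)⁻¹ • y)) with hh
  have e1 : ∀ z, phi z • (g (s • x + sg s • z) * q z) = h (sg s • z) := by
    intro z
    simp only [hh, smul_smul, inv_mul_cancel₀ hσ.ne', one_smul, smul_eq_mul]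
  simp_rw [e1]
  rw [Measure.integral_comp_smul, ← integral_sub_right_eq_self h (s • x), smul_eq_mul,
    ← integral_const_mul]
  congr 1; ext w
  simp only [hh, finrank_euclideanSpace, Fintype.card_fin, add_sub_cancel]
  rw [abs_of_pos (by positivity), phi, PP, norm_smul, Real.norm_of_nonneg (by positivity),
    ← sg_sq hs]
  have e2 : (sg s ^ 2) ^ (-((d : ℝ) / 2)) = (sg s ^ d)⁻¹ := by
    rw [← Real.rpow_natCast (sg s) 2, ← Real.rpow_mul hσ.le, ← Real.rpow_natCast (sg s) d,
      ← Real.rpow_neg hσ.le]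
    congr 1
    push_cast; ring
  rw [e2]
  have e3 : -((sg s)⁻¹ * ‖w - s • x‖) ^ 2 / 2 = -(‖w - s • x‖ ^ 2) / (2 * sg s ^ 2) := by
    field_simp
  rw [e3]; ring

lemma hasDerivAt_PP {d : ℕ} (x w : EuclideanSpace ℝ (Fin d)) {s : ℝ}
    (hs : s ∈ Set.Ioo (0 : ℝ) 1) :
    HasDerivAt (fun s => PP x s w) (PP x s w * QQ x s w) s := by
  have hv : 0 < 1 - s ^ 2 := by nlinarith [hs.1, hs.2]
  have h1 : HasDerivAt (fun s : ℝ => 1 - s ^ 2) (-(2 * s)) s := by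
    simpa using (hasDerivAt_pow 2 s).const_sub 1
  have h2 := h1.rpow_const (p := -((d : ℝ) / 2)) (Or.inl hv.ne')
  have h3 : HasDerivAt (fun s : ℝ => w - s • x) (-x) s := by
    simpa using ((hasDerivAt_id s).smul_const x).const_sub w
  have h4 := h3.norm_sq
  have h5 := (h4.neg.div (h1.const_mul 2) (by positivity)).exp
  have h6 := (h2.const_mul (cst d)).mul h5
  refine h6.congr_deriv ?_
  simp only [PP, QQ, inner_neg_right]
  rw [Real.rpow_sub_one hv.ne']
  simp only [Pi.neg_apply, Pi.div_apply]
  field_simp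
  ring

lemma abs_inner_le' {d : ℕ} (x y : EuclideanSpace ℝ (Fin d)) : |⟪x, y⟫| ≤ ‖x‖ * ‖y‖ :=
  abs_real_inner_le_norm x y

lemma PP_bound {d : ℕ} (x w : EuclideanSpace ℝ (Fin d)) {s v : ℝ} (hs : s ∈ Set.Ioo (0 : ℝ) 1)
    (hv : 0 < v) (hvs : v ≤ 1 - s ^ 2) :
    |PP x s w| ≤ cst d * v ^ (-((d : ℝ) / 2)) * Real.exp (‖x‖ ^ 2 / 2) *
      Real.exp (-‖w‖ ^ 2 / 4) := by
  have hc := cst_pos d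
  have hv1 : 0 < 1 - s ^ 2 := hv.trans_le hvs
  have h0 : 0 ≤ PP x s w := by unfold PP; positivity
  rw [abs_of_nonneg h0, PP, mul_assoc (_ * _)]
  have h1 : (1 - s ^ 2) ^ (-((d : ℝ) / 2)) ≤ v ^ (-((d : ℝ) / 2)) :=
    Real.rpow_le_rpow_of_nonpos hv hvs (by simp; positivity)
  have h2 : Real.exp (-(‖w - s • x‖ ^ 2) / (2 * (1 - s ^ 2))) ≤
      Real.exp (-‖w - s • x‖ ^ 2 / 2) := by
    apply Real.exp_le_exp.2
    rw [neg_div, neg_div, neg_le_neg_iff]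
    gcongr
    nlinarith [sq_nonneg s]
  have h3 := exp_shift_le w (s • x)
  have h4 : ‖s • x‖ ≤ ‖x‖ := by
    rw [norm_smul, Real.norm_of_nonneg hs.1.le]
    nlinarith [norm_nonneg x, hs.2]
  have h5 : Real.exp (‖s • x‖ ^ 2 / 2) ≤ Real.exp (‖x‖ ^ 2 / 2) := by gcongr
  gcongr
  refine h2.trans (h3.trans ?_)
  gcongr

lemma QQ_bound {d : ℕ} (x w : EuclideanSpace ℝ (Fin d)) {s v : ℝ} (hs : s ∈ Set.Ioo (0 : ℝ) 1)
    (hv : 0 < v) (hvs : v ≤ 1 - s ^ 2) :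
    |QQ x s w| ≤ (d / v + (1 + ‖x‖) * ‖x‖ / v + (1 + ‖x‖) ^ 2 / v ^ 2) * (1 + ‖w‖) ^ 2 := by
  have hv1 : 0 < 1 - s ^ 2 := hv.trans_le hvs
  have hw := norm_nonneg w
  have hx := norm_nonneg x
  have hn : ‖w - s • x‖ ≤ (1 + ‖x‖) * (1 + ‖w‖) := by
    refine (norm_sub_le _ _).trans ?_
    rw [norm_smul, Real.norm_of_nonneg hs.1.le]
    nlinarith [hs.2, mul_nonneg hw hx]
  have hone : 1 ≤ 1 + ‖w‖ := by linarith
  have hone2 : 1 ≤ (1 + ‖w‖) ^ 2 := one_le_pow₀ hone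
  have hone3 : 1 + ‖w‖ ≤ (1 + ‖w‖) ^ 2 := by nlinarith
  have a1 : |d * s / (1 - s ^ 2)| ≤ d / v * (1 + ‖w‖) ^ 2 := by
    rw [abs_of_nonneg (div_nonneg (mul_nonneg (by positivity) hs.1.le) hv1.le)]
    calc d * s / (1 - s ^ 2) ≤ d * 1 / v := by
          gcongr
          exact hs.2.le
      _ = d / v * 1 := by ring
      _ ≤ _ := by gcongr
  have a2 : |⟪w - s • x, x⟫ / (1 - s ^ 2)| ≤ (1 + ‖x‖) * ‖x‖ / v * (1 + ‖w‖) ^ 2 := by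
    rw [abs_div, abs_of_pos hv1]
    calc _ ≤ ((1 + ‖x‖) * (1 + ‖w‖) ^ 2) * ‖x‖ / v := by
          gcongr
          refine (abs_inner_le' _ _).trans ?_
          gcongr
          exact hn.trans (by gcongr)
      _ = _ := by ring
  have a3 : |s * ‖w - s • x‖ ^ 2 / (1 - s ^ 2) ^ 2| ≤
      (1 + ‖x‖) ^ 2 / v ^ 2 * (1 + ‖w‖) ^ 2 := by
    rw [abs_of_nonneg (div_nonneg (mul_nonneg hs.1.le (by positivity)) (by positivity))]
    calc _ ≤ 1 * ((1 + ‖x‖) * (1 + ‖w‖)) ^ 2 / v ^ 2 := by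
          gcongr
          exact hs.2.le
      _ = _ := by ring
  unfold QQ
  refine (abs_sub _ _).trans ((add_le_add (abs_add_le _ _) le_rfl).trans ?_)
  linarith

lemma hasDerivAt_Gs {d : ℕ} {g : EuclideanSpace ℝ (Fin d) → ℝ} {L : ℝ} (hL : 0 ≤ L)
    (hg : ∀ x y, |g x - g y| ≤ L * ‖x - y‖) {s : ℝ} (hs : s ∈ Set.Ioo (0 : ℝ) 1)
    (x : EuclideanSpace ℝ (Fin d)) :
    HasDerivAt (fun s => Gs g s x) (-(s⁻¹ * (trL d (Hs g s x) - ⟪x, ms g s x⟫))) s := by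
  have hgc := continuous_of_lip hg
  have hσ := sg_pos hs
  have eG : ∀ r ∈ Set.Ioo (0 : ℝ) 1, Gs g r x = ∫ w, g w * PP x r w := by
    intro r hr
    have := cov g (fun _ => 1) hr x
    simpa [Gs] using this
  have hval : -(s⁻¹ * (trL d (Hs g s x) - ⟪x, ms g s x⟫)) = ∫ w, g w * (PP x s w * QQ x s w) := by
    have h := cov g (fun z => (d * s / (1 - s ^ 2) + ⟪x, z⟫ / sg s - s * ‖z‖ ^ 2 / (1 - s ^ 2))) hs x
    have e : ∀ w, (d * s / (1 - s ^ 2) + ⟪x, (sg s)⁻¹ • (w - s • x)⟫ / sg s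
        - s * ‖(sg s)⁻¹ • (w - s • x)‖ ^ 2 / (1 - s ^ 2)) = QQ x s w := by
      intro w
      rw [QQ, inner_smul_right, norm_smul, Real.norm_of_nonneg (by positivity), ← sg_sq hs,
        real_inner_comm]
      field_simp
    simp_rw [e] at h
    rw [← h, trL_Hs hL hg, inner_ms hL hg]
    have i1 : Integrable (fun z => g (s • x + sg s • z) * (‖z‖ ^ 2 - d)) (gam d) := by
      refine int_g hL hg (q := fun z => ‖z‖ ^ 2 - (d : ℝ)) (C := 1 + d) (by fun_prop) (fun z => ?_) _ _
      rw [Real.norm_eq_abs]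
      refine (abs_sub _ _).trans ?_
      have hz := norm_nonneg z
      have hdd : (0 : ℝ) ≤ d := by positivity
      rw [abs_of_nonneg (by positivity), abs_of_nonneg hdd]
      nlinarith [mul_nonneg hdd hz, mul_nonneg hdd (mul_nonneg hz hz)]
    have i2 : Integrable (fun z => g (s • x + sg s • z) * ⟪x, z⟫) (gam d) := by
      refine int_g hL hg (q := fun z => ⟪x, z⟫) (C := ‖x‖) (by fun_prop) (fun z => ?_) _ _
      refine (abs_inner_le' _ _).trans ?_
      have := norm_id_bound z
      rw [one_mul] at this
      gcongr
    have e2 : ∀ z, g (s • x + sg s • z) *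
        (d * s / (1 - s ^ 2) + ⟪x, z⟫ / sg s - s * ‖z‖ ^ 2 / (1 - s ^ 2)) =
        (sg s)⁻¹ * (g (s • x + sg s • z) * ⟪x, z⟫) -
        s / (1 - s ^ 2) * (g (s • x + sg s • z) * (‖z‖ ^ 2 - d)) := by
      intro z; ring
    simp_rw [e2]
    rw [integral_sub (i2.const_mul _) (i1.const_mul _), integral_const_mul, integral_const_mul,
      ← sg_sq hs]
    have := hs.1.ne'
    field_simp
    ring
  rw [hval]
  set b := (1 + s) / 2 with hb
  have hsb : s < b := by rw [hb]; linarith [hs.2]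
  have hb1 : b < 1 := by rw [hb]; linarith [hs.2]
  set v := 1 - b ^ 2 with hvdef
  have hv : 0 < v := by rw [hvdef]; nlinarith [hs.1]
  have hvr : ∀ r ∈ Set.Ioo 0 b, v ≤ 1 - r ^ 2 := by
    intro r hr; rw [hvdef]; nlinarith [hr.1, hr.2]
  have hrI : ∀ r ∈ Set.Ioo 0 b, r ∈ Set.Ioo (0 : ℝ) 1 := fun r hr => ⟨hr.1, hr.2.trans hb1⟩
  have hPm : ∀ r, Continuous (PP x r) := by intro r; unfold PP; fun_prop
  have hQm : ∀ r, Continuous (QQ x r) := by intro r; unfold QQ; fun_prop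
  set K1 := cst d * v ^ (-((d : ℝ) / 2)) * Real.exp (‖x‖ ^ 2 / 2) with hK1
  set K2 := (d / v + (1 + ‖x‖) * ‖x‖ / v + (1 + ‖x‖) ^ 2 / v ^ 2) with hK2
  have hK1p : 0 ≤ K1 := by have := cst_pos d; positivity
  have hK2p : 0 ≤ K2 := by positivity
  have hgr : ∀ w, |g w| ≤ (|g 0| + L) * (1 + ‖w‖) := by
    intro w; simpa using growth hL hg 0 w 1
  have hK0 : 0 ≤ |g 0| + L := by positivity
  have hint := (integrable_dom d 3).const_mul ((|g 0| + L) * K1 * K2)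
  have hint1 := (integrable_dom d 1).const_mul ((|g 0| + L) * K1)
  have main := (hasDerivAt_integral_of_dominated_loc_of_deriv_le (μ := volume) (s := Set.Ioo 0 b)
    (F := fun r w => g w * PP x r w) (F' := fun r w => g w * (PP x r w * QQ x r w))
    (bound := fun w => (|g 0| + L) * K1 * K2 * ((1 + ‖w‖) ^ 3 * Real.exp (-‖w‖ ^ 2 / 4)))
    (x₀ := s) (Ioo_mem_nhds hs.1 hsb)
    (Filter.Eventually.of_forall fun r => (hgc.mul (hPm r)).aestronglyMeasurable)
    (by
      refine hint1.mono' (hgc.mul (hPm s)).aestronglyMeasurable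
        (Filter.Eventually.of_forall fun w => ?_)
      rw [norm_mul, Real.norm_eq_abs, Real.norm_eq_abs]
      calc _ ≤ ((|g 0| + L) * (1 + ‖w‖)) * (K1 * Real.exp (-‖w‖ ^ 2 / 4)) := by
            gcongr
            · exact hgr w
            · exact PP_bound x w hs hv (hvr s ⟨hs.1, hsb⟩)
        _ = _ := by ring)
    (hgc.mul ((hPm s).mul (hQm s))).aestronglyMeasurable
    (by
      refine Filter.Eventually.of_forall fun w r hr => ?_
      rw [norm_mul, norm_mul, Real.norm_eq_abs, Real.norm_eq_abs, Real.norm_eq_abs]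
      calc _ ≤ ((|g 0| + L) * (1 + ‖w‖)) * ((K1 * Real.exp (-‖w‖ ^ 2 / 4)) *
            (K2 * (1 + ‖w‖) ^ 2)) := by
            gcongr
            · exact hgr w
            · exact PP_bound x w (hrI r hr) hv (hvr r hr)
            · exact QQ_bound x w (hrI r hr) hv (hvr r hr)
        _ = _ := by ring)
    hint
    (Filter.Eventually.of_forall fun w r hr => (hasDerivAt_PP x w (hrI r hr)).const_mul (g w))).2
  refine main.congr_of_eventuallyEq ?_
  filter_upwards [Ioo_mem_nhds hs.1 hs.2] with r hr
  exact eG r hr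

lemma lip_shift {d : ℕ} {g : EuclideanSpace ℝ (Fin d) → ℝ} {L : ℝ}
    (hg : ∀ x y, |g x - g y| ≤ L * ‖x - y‖) {s : ℝ} (hs : 0 ≤ s) (x y w : EuclideanSpace ℝ (Fin d)) :
    |g (s • x + w) - g (s • y + w)| ≤ L * s * ‖x - y‖ := by
  refine (hg _ _).trans (le_of_eq ?_)
  rw [add_sub_add_right_eq_sub, ← smul_sub, norm_smul, Real.norm_of_nonneg hs, mul_assoc]

lemma diff_bound {d : ℕ} {g : EuclideanSpace ℝ (Fin d) → ℝ} {L : ℝ} (hL : 0 ≤ L)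
    (hg : ∀ x y, |g x - g y| ≤ L * ‖x - y‖)
    {q : EuclideanSpace ℝ (Fin d) → ℝ} (hq : Continuous q) {C : ℝ}
    (hC : ∀ z, ‖q z‖ ≤ C * (1 + ‖z‖) ^ 2) {s : ℝ} (hs : 0 ≤ s) (x y : EuclideanSpace ℝ (Fin d)) :
    |(∫ z, g (s • x + sg s • z) * q z ∂(gam d)) - ∫ z, g (s • y + sg s • z) * q z ∂(gam d)| ≤
      L * s * ‖x - y‖ * ∫ z, |q z| ∂(gam d) := by
  have i1 := int_g hL hg hq hC (s • x) (sg s)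
  have i2 := int_g hL hg hq hC (s • y) (sg s)
  have i3 : Integrable q (gam d) := integrable_gam_of_le hq.aestronglyMeasurable C hC
  simp only [smul_eq_mul] at i1 i2
  rw [← integral_sub i1 i2, ← integral_const_mul]
  refine abs_integral_le_integral_abs.trans (integral_mono (i1.sub i2).abs (i3.abs.const_mul _) ?_)
  intro z
  simp only
  rw [← sub_mul, abs_mul]
  gcongr
  exact lip_shift hg hs x y _

lemma Gs_lip {d : ℕ} {g : EuclideanSpace ℝ (Fin d) → ℝ} {L : ℝ} (hL : 0 ≤ L)
    (hg : ∀ x y, |g x - g y| ≤ L * ‖x - y‖) {s : ℝ} (hs : 0 ≤ s) (x y : EuclideanSpace ℝ (Fin d)) :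
    |Gs g s x - Gs g s y| ≤ L * s * ‖x - y‖ := by
  have := diff_bound hL hg (q := fun _ => 1) continuous_const (C := 1)
    (fun z => by
      have h : 1 ≤ (1 + ‖z‖) ^ 2 := one_le_pow₀ (by linarith [norm_nonneg z])
      rw [norm_one, one_mul]; exact h) hs x y
  simpa [Gs] using this

lemma norm_ms_le {d : ℕ} {g : EuclideanSpace ℝ (Fin d) → ℝ} {L : ℝ} (hL : 0 ≤ L)
    (hg : ∀ x y, |g x - g y| ≤ L * ‖x - y‖) {s : ℝ} (hs : s ∈ Set.Ioo (0 : ℝ) 1)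
    (x : EuclideanSpace ℝ (Fin d)) : ‖ms g s x‖ ≤ L * s := by
  have h := (hasFDerivAt_Gs hL hg hs x).le_of_lip' (C := L * s) (mul_nonneg hL hs.1.le)
    (Filter.Eventually.of_forall fun y => Gs_lip hL hg hs.1.le y x)
  rwa [innerSL_apply_norm] at h

lemma ms_lip {d : ℕ} {g : EuclideanSpace ℝ (Fin d) → ℝ} {L : ℝ} (hL : 0 ≤ L)
    (hg : ∀ x y, |g x - g y| ≤ L * ‖x - y‖) {s : ℝ} (hs : s ∈ Set.Ioo (0 : ℝ) 1)
    (x y : EuclideanSpace ℝ (Fin d)) :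
    ‖ms g s x - ms g s y‖ ≤ L * s ^ 2 / sg s * ‖x - y‖ := by
  have hσ := sg_pos hs
  have hs0 := hs.1
  have key : ∀ u, |⟪u, ms g s x - ms g s y⟫| ≤ L * s ^ 2 / sg s * ‖x - y‖ * ‖u‖ := by
    intro u
    rw [inner_sub_right, inner_ms hL hg, inner_ms hL hg, ← mul_sub, abs_mul,
      abs_of_pos (by positivity)]
    have h1 := diff_bound hL hg (q := fun z => ⟪u, z⟫) (by fun_prop) (C := ‖u‖) (fun z => by
      refine (abs_inner_le' _ _).trans ?_
      have := norm_id_bound z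
      rw [one_mul] at this
      gcongr) hs.1.le x y
    have h2 := integral_abs_inner u
    simp_rw [real_inner_comm u] at h2
    calc _ ≤ s / sg s * (L * s * ‖x - y‖ * ‖u‖) := by
          gcongr
          refine h1.trans ?_
          gcongr
      _ = _ := by ring
  have h := key (ms g s x - ms g s y)
  rw [real_inner_self_eq_norm_sq, abs_of_nonneg (by positivity), sq] at h
  by_cases h0 : ‖ms g s x - ms g s y‖ = 0
  · rw [h0]; positivity
  · exact le_of_mul_le_mul_right h (lt_of_le_of_ne (norm_nonneg _) (Ne.symm h0))

lemma norm_Hs_le {d : ℕ} {g : EuclideanSpace ℝ (Fin d) → ℝ} {L : ℝ} (hL : 0 ≤ L)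
    (hg : ∀ x y, |g x - g y| ≤ L * ‖x - y‖) {s : ℝ} (hs : s ∈ Set.Ioo (0 : ℝ) 1)
    (x : EuclideanSpace ℝ (Fin d)) : ‖Hs g s x‖ ≤ L * s ^ 2 / sg s :=
  (hasFDerivAt_ms hL hg hs x).le_of_lip' (by have := sg_pos hs; positivity)
    (Filter.Eventually.of_forall fun y => ms_lip hL hg hs y x)

lemma inner_Hs {d : ℕ} {g : EuclideanSpace ℝ (Fin d) → ℝ} {L : ℝ} (hL : 0 ≤ L)
    (hg : ∀ x y, |g x - g y| ≤ L * ‖x - y‖) (s : ℝ) (x u v : EuclideanSpace ℝ (Fin d)) :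
    ⟪u, Hs g s x v⟫ = (s / sg s) ^ 2 *
      ∫ z, g (s • x + sg s • z) * (⟪z, u⟫ * ⟪z, v⟫ - ⟪u, v⟫) ∂(gam d) := by
  have hc : Continuous fun z : EuclideanSpace ℝ (Fin d) => ten z - ContinuousLinearMap.id ℝ _ :=
    continuous_ten.sub continuous_const
  have h := ((innerSL ℝ u) ∘L (ContinuousLinearMap.apply ℝ (EuclideanSpace ℝ (Fin d)) v)).integral_comp_comm
    (int_g hL hg hc norm_ten_sub_id (s • x) (sg s))
  simp only [ContinuousLinearMap.comp_apply, ContinuousLinearMap.apply_apply,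
    innerSL_apply_apply, smul_apply, sub_apply, ContinuousLinearMap.id_apply,
    ten_apply, inner_smul_right, inner_sub_right] at h
  rw [Hs, smul_apply, inner_smul_right, ← h]
  congr 2; ext z
  rw [real_inner_comm z u]; ring

lemma Hs_lip {d : ℕ} {g : EuclideanSpace ℝ (Fin d) → ℝ} {L : ℝ} (hL : 0 ≤ L)
    (hg : ∀ x y, |g x - g y| ≤ L * ‖x - y‖) {s : ℝ} (hs : s ∈ Set.Ioo (0 : ℝ) 1)
    (x y : EuclideanSpace ℝ (Fin d)) :
    ‖Hs g s x - Hs g s y‖ ≤ 2 * (L * s ^ 2 / sg s) * (s * ‖x - y‖ / sg s) := by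
  have hσ := sg_pos hs
  have hs0 := hs.1
  have key : ∀ u v, |⟪u, (Hs g s x - Hs g s y) v⟫| ≤
      2 * (L * s ^ 2 / sg s) * (s * ‖x - y‖ / sg s) * ‖v‖ * ‖u‖ := by
    intro u v
    rw [sub_apply, inner_sub_right, inner_Hs hL hg, inner_Hs hL hg, ← mul_sub, abs_mul,
      abs_of_pos (by positivity)]
    have h1 := diff_bound hL hg (q := fun z => ⟪z, u⟫ * ⟪z, v⟫ - ⟪u, v⟫) (by fun_prop)
      (C := ‖u‖ * ‖v‖) (fun z => by
      refine (abs_sub _ _).trans ?_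
      rw [abs_mul]
      have a1 := abs_inner_le' z u
      have a2 := abs_inner_le' z v
      have a3 := abs_inner_le' u v
      calc _ ≤ (‖z‖ * ‖u‖) * (‖z‖ * ‖v‖) + ‖u‖ * ‖v‖ := by gcongr
        _ = ‖u‖ * ‖v‖ * (‖z‖ ^ 2 + 1) := by ring
        _ ≤ _ := by gcongr; nlinarith [norm_nonneg z]) hs.1.le x y
    have h2 : ∫ z, |⟪z, u⟫ * ⟪z, v⟫ - ⟪u, v⟫| ∂(gam d) ≤ 2 * (‖u‖ * ‖v‖) := by
      have i := integrable_inner_mul u v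
      calc _ ≤ ∫ z, (|⟪z, u⟫ * ⟪z, v⟫| + |⟪u, v⟫|) ∂(gam d) := by
            refine integral_mono (i.sub (integrable_const _)).abs
              (i.abs.add (integrable_const _)) fun z => ?_
            exact abs_sub _ _
        _ ≤ _ := by
            rw [integral_add i.abs (integrable_const _)]
            have := integral_abs_inner_mul u v
            have := abs_inner_le' u v
            simp only [integral_const, probReal_univ, smul_eq_mul, one_mul]
            linarith
    calc _ ≤ (s / sg s) ^ 2 * (L * s * ‖x - y‖ * (2 * (‖u‖ * ‖v‖))) := by
          gcongr
          refine h1.trans ?_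
          gcongr
      _ = _ := by ring
  refine ContinuousLinearMap.opNorm_le_bound _ (by positivity) fun v => ?_
  have h := key ((Hs g s x - Hs g s y) v) v
  rw [real_inner_self_eq_norm_sq, abs_of_nonneg (by positivity), sq] at h
  by_cases h0 : ‖(Hs g s x - Hs g s y) v‖ = 0
  · rw [h0]; positivity
  · exact le_of_mul_le_mul_right h (lt_of_le_of_ne (norm_nonneg _) (Ne.symm h0))

/-- The weight controlling the Hessian difference. -/
def WW (β s : ℝ) : ℝ := s * (1 - s ^ 2) ^ (-((1 + β) / 2))

lemma WW_eq {β s : ℝ} (hs : s ∈ Set.Ioo (0 : ℝ) 1) : WW β s = s * (sg s)⁻¹ * (sg s) ^ (-β) := by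
  have hσ := sg_pos hs
  rw [WW, ← sg_sq hs, ← Real.rpow_natCast (sg s) 2, ← Real.rpow_mul hσ.le, mul_assoc,
    ← Real.rpow_neg_one, ← Real.rpow_add hσ]
  congr 2
  push_cast; ring

lemma Hs_holder {d : ℕ} {g : EuclideanSpace ℝ (Fin d) → ℝ} {L : ℝ} (hL : 0 ≤ L)
    (hg : ∀ x y, |g x - g y| ≤ L * ‖x - y‖) {s β : ℝ} (hs : s ∈ Set.Ioo (0 : ℝ) 1)
    (hβ : β ∈ Set.Ioo (0 : ℝ) 1) (x y : EuclideanSpace ℝ (Fin d)) :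
    ‖s⁻¹ • Hs g s x - s⁻¹ • Hs g s y‖ ≤ 2 * L * ‖x - y‖ ^ β * WW β s := by
  have hσ := sg_pos hs
  have hs0 := hs.1
  set t := s * ‖x - y‖ / sg s with ht
  have ht0 : 0 ≤ t := by positivity
  set A := 2 * (L * s ^ 2 / sg s) with hA
  have hA0 : 0 ≤ A := by positivity
  have h1 : ‖Hs g s x - Hs g s y‖ ≤ A * t := Hs_lip hL hg hs x y
  have h2 : ‖Hs g s x - Hs g s y‖ ≤ A := by
    refine (norm_sub_le _ _).trans ?_
    have := norm_Hs_le hL hg hs x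
    have := norm_Hs_le hL hg hs y
    rw [hA]; linarith
  have h3 : ‖Hs g s x - Hs g s y‖ ≤ A * t ^ β := by
    rcases le_total t 1 with h | h
    · refine h1.trans ?_
      gcongr
      calc t = t ^ (1 : ℝ) := (Real.rpow_one t).symm
        _ ≤ t ^ β := Real.rpow_le_rpow_of_exponent_ge' ht0 h hβ.1.le hβ.2.le
    · refine h2.trans ?_
      have := Real.one_le_rpow h hβ.1.le
      nlinarith
  have h4 : t ^ β ≤ ‖x - y‖ ^ β * sg s ^ (-β) := by
    rw [Real.rpow_neg hσ.le, ← div_eq_mul_inv, ← Real.div_rpow (norm_nonneg _) hσ.le]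
    apply Real.rpow_le_rpow ht0 _ hβ.1.le
    rw [ht]
    gcongr
    nlinarith [hs.2, norm_nonneg (x - y)]
  have e : s⁻¹ • Hs g s x - s⁻¹ • Hs g s y = s⁻¹ • (Hs g s x - Hs g s y) := (smul_sub _ _ _).symm
  rw [e, norm_smul, Real.norm_of_nonneg (by positivity), WW_eq hs]
  calc _ ≤ s⁻¹ * (A * (‖x - y‖ ^ β * sg s ^ (-β))) := by
        gcongr
        exact h3.trans (by gcongr)
    _ = _ := by
        rw [hA]
        field_simp

lemma WW_int {β : ℝ} (h0 : 0 ≤ β) (h1 : β < 1) :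
    IntegrableOn (WW β) (Set.Ioo 0 1) ∧ ∫ s in Set.Ioo 0 1, WW β s = 1 / (1 - β) := by
  set A : ℝ → ℝ := fun s => -((1 - s ^ 2) ^ ((1 - β) / 2) / (1 - β)) with hA
  have hb : 0 < 1 - β := by linarith
  have hc : Continuous A := by
    have : Continuous fun s : ℝ => (1 - s ^ 2) ^ ((1 - β) / 2) :=
      Continuous.rpow_const (by fun_prop) fun x => Or.inr (by positivity)
    exact (this.div_const _).neg
  have hd : ∀ s ∈ Set.Ioo (0 : ℝ) 1, HasDerivAt A (WW β s) s := by
    intro s hs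
    have hv : 0 < 1 - s ^ 2 := by nlinarith [hs.1, hs.2]
    have h1 : HasDerivAt (fun s : ℝ => 1 - s ^ 2) (-(2 * s)) s := by
      simpa using (hasDerivAt_pow 2 s).const_sub 1
    have h2 := ((h1.rpow_const (p := (1 - β) / 2) (Or.inl hv.ne')).div_const (1 - β)).neg
    refine h2.congr_deriv ?_
    rw [WW, show (1 - β) / 2 - 1 = -((1 + β) / 2) by ring]
    field_simp
  have hpos : ∀ s ∈ Set.Ioo (0 : ℝ) 1, 0 ≤ WW β s := by
    intro s hs
    have hv : 0 < 1 - s ^ 2 := by nlinarith [hs.1, hs.2]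
    have := hs.1
    unfold WW; positivity
  have hI := intervalIntegral.integrableOn_deriv_of_nonneg hc.continuousOn hd hpos
  refine ⟨hI.mono_set Set.Ioo_subset_Ioc_self, ?_⟩
  have h := intervalIntegral.integral_eq_sub_of_hasDerivAt_of_le zero_le_one hc.continuousOn hd
    ((intervalIntegrable_iff_integrableOn_Ioc_of_le zero_le_one).2 hI)
  rw [intervalIntegral.integral_of_le zero_le_one, integral_Ioc_eq_integral_Ioo] at h
  rw [h, hA]
  have : (0 : ℝ) ^ ((1 - β) / 2) = 0 := Real.zero_rpow (by positivity)
  simp [this]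

lemma meas_s {d : ℕ} {g : EuclideanSpace ℝ (Fin d) → ℝ} (hg : Continuous g) {F : Type*}
    [NormedAddCommGroup F] [NormedSpace ℝ F] [FiniteDimensional ℝ F]
    {q : EuclideanSpace ℝ (Fin d) → F} (hq : Continuous q) (x : EuclideanSpace ℝ (Fin d)) :
    StronglyMeasurable fun s => ∫ z, g (s • x + sg s • z) • q z ∂(gam d) := by
  have hc : Continuous (fun p : ℝ × EuclideanSpace ℝ (Fin d) =>
      g (p.1 • x + sg p.1 • p.2) • q p.2) := by
    have := continuous_sg
    fun_prop
  exact hc.stronglyMeasurable.integral_prod_right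

lemma meas_Gs {d : ℕ} {g : EuclideanSpace ℝ (Fin d) → ℝ} (hg : Continuous g)
    (x : EuclideanSpace ℝ (Fin d)) : StronglyMeasurable fun s => Gs g s x := by
  have := meas_s hg (q := fun _ => (1 : ℝ)) continuous_const x
  simpa [Gs] using this

lemma meas_ms {d : ℕ} {g : EuclideanSpace ℝ (Fin d) → ℝ} (hg : Continuous g)
    (x : EuclideanSpace ℝ (Fin d)) : StronglyMeasurable fun s => ms g s x := by
  have := meas_s hg (q := fun z => z) continuous_id x
  have h2 : Measurable fun s : ℝ => s / sg s := by
    have := continuous_sg.measurable; fun_prop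
  exact h2.stronglyMeasurable.smul this

lemma meas_Hs {d : ℕ} {g : EuclideanSpace ℝ (Fin d) → ℝ} (hg : Continuous g)
    (x : EuclideanSpace ℝ (Fin d)) : StronglyMeasurable fun s => Hs g s x := by
  have hc : Continuous fun z : EuclideanSpace ℝ (Fin d) => ten z - ContinuousLinearMap.id ℝ _ :=
    continuous_ten.sub continuous_const
  have := meas_s hg hc x
  have h2 : Measurable fun s : ℝ => (s / sg s) ^ 2 := by
    have := continuous_sg.measurable; fun_prop
  exact h2.stronglyMeasurable.smul this

/-- Lebesgue measure on the unit interval. -/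
def mu1 : Measure ℝ := volume.restrict (Set.Ioo (0 : ℝ) 1)

instance : IsFiniteMeasure mu1 := by
  unfold mu1; infer_instance

lemma ae_mu1 {p : ℝ → Prop} (h : ∀ s ∈ Set.Ioo (0 : ℝ) 1, p s) : ∀ᵐ s ∂mu1, p s :=
  ae_restrict_of_forall_mem measurableSet_Ioo h

lemma Gs_sub_le {d : ℕ} {g : EuclideanSpace ℝ (Fin d) → ℝ} {L : ℝ} (hL : 0 ≤ L)
    (hg : ∀ x y, |g x - g y| ≤ L * ‖x - y‖) {s : ℝ} (hs : s ∈ Set.Ioo (0 : ℝ) 1)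
    (x : EuclideanSpace ℝ (Fin d)) :
    |Gs g s x - ∫ z, g z ∂(gam d)| ≤ s * (L * (‖x‖ + ∫ z, ‖z‖ ∂(gam d))) := by
  have h1 : ∀ z : EuclideanSpace ℝ (Fin d), ‖(1 : ℝ)‖ ≤ 1 * (1 + ‖z‖) ^ 2 := fun z => by
    have h : 1 ≤ (1 + ‖z‖) ^ 2 := one_le_pow₀ (by linarith [norm_nonneg z])
    rw [norm_one, one_mul]; exact h
  have i1 := int_g hL hg (q := fun _ => (1 : ℝ)) continuous_const h1 (s • x) (sg s)
  have i2 := int_g hL hg (q := fun _ => (1 : ℝ)) continuous_const h1 0 1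
  have i3 : Integrable (fun z : EuclideanSpace ℝ (Fin d) => ‖z‖) (gam d) := by
    refine integrable_gam_of_le (n := 2) continuous_norm.aestronglyMeasurable 1 fun z => ?_
    rw [norm_norm]; exact norm_id_bound z
  simp only [smul_eq_mul, mul_one, zero_add, one_smul] at i1 i2
  have hσ : 1 - sg s ≤ s := by
    have a1 := sg_sq hs
    have a2 := sg_le_one s
    have a3 := sg_nonneg s
    nlinarith [hs.1, hs.2]
  rw [Gs, ← integral_sub i1 i2]
  calc _ ≤ ∫ z, s * (L * (‖x‖ + ‖z‖)) ∂(gam d) := by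
        refine abs_integral_le_integral_abs.trans (integral_mono (i1.sub i2).abs
          ((((integrable_const _).add i3).const_mul _).const_mul _) ?_)
        intro z
        simp only
        refine (hg _ _).trans ?_
        have e : s • x + sg s • z - z = s • x - (1 - sg s) • z := by module
        have : ‖s • x + sg s • z - z‖ ≤ s * ‖x‖ + s * ‖z‖ := by
          rw [e]
          refine (norm_sub_le _ _).trans ?_
          rw [norm_smul, norm_smul, Real.norm_of_nonneg hs.1.le,
            Real.norm_of_nonneg (by linarith [sg_le_one s])]
          gcongr
        calc _ ≤ L * (s * ‖x‖ + s * ‖z‖) := by gcongr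
          _ = _ := by ring
    _ = _ := by
        rw [integral_const_mul, integral_const_mul, integral_add (integrable_const _) i3]
        simp

lemma int_F {d : ℕ} {g : EuclideanSpace ℝ (Fin d) → ℝ} {L : ℝ} (hL : 0 ≤ L)
    (hg : ∀ x y, |g x - g y| ≤ L * ‖x - y‖) (x : EuclideanSpace ℝ (Fin d)) :
    Integrable (fun s => s⁻¹ * (Gs g s x - ∫ z, g z ∂(gam d))) mu1 := by
  refine Integrable.of_bound (C := L * (‖x‖ + ∫ z, ‖z‖ ∂(gam d))) ?_ (ae_mu1 fun s hs => ?_)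
  · exact (measurable_inv.stronglyMeasurable.mul ((meas_Gs (continuous_of_lip hg) x).sub
      stronglyMeasurable_const)).aestronglyMeasurable
  · rw [norm_mul, norm_inv, Real.norm_of_nonneg hs.1.le, inv_mul_le_iff₀ hs.1]
    exact Gs_sub_le hL hg hs x

lemma meas_D {d : ℕ} {g : EuclideanSpace ℝ (Fin d) → ℝ} (hg : Continuous g)
    (x : EuclideanSpace ℝ (Fin d)) : AEStronglyMeasurable (fun s => s⁻¹ • ms g s x) mu1 :=
  (measurable_inv.stronglyMeasurable.smul (meas_ms hg x)).aestronglyMeasurable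

lemma meas_H {d : ℕ} {g : EuclideanSpace ℝ (Fin d) → ℝ} (hg : Continuous g)
    (x : EuclideanSpace ℝ (Fin d)) : AEStronglyMeasurable (fun s => s⁻¹ • Hs g s x) mu1 :=
  (measurable_inv.stronglyMeasurable.smul (meas_Hs hg x)).aestronglyMeasurable

lemma bound_D {d : ℕ} {g : EuclideanSpace ℝ (Fin d) → ℝ} {L : ℝ} (hL : 0 ≤ L)
    (hg : ∀ x y, |g x - g y| ≤ L * ‖x - y‖) {s : ℝ} (hs : s ∈ Set.Ioo (0 : ℝ) 1)
    (x : EuclideanSpace ℝ (Fin d)) : ‖s⁻¹ • ms g s x‖ ≤ L := by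
  rw [norm_smul, norm_inv, Real.norm_of_nonneg hs.1.le, inv_mul_le_iff₀ hs.1, mul_comm]
  exact norm_ms_le hL hg hs x

lemma bound_H {d : ℕ} {g : EuclideanSpace ℝ (Fin d) → ℝ} {L : ℝ} (hL : 0 ≤ L)
    (hg : ∀ x y, |g x - g y| ≤ L * ‖x - y‖) {s : ℝ} (hs : s ∈ Set.Ioo (0 : ℝ) 1)
    (x : EuclideanSpace ℝ (Fin d)) : ‖s⁻¹ • Hs g s x‖ ≤ L * WW 0 s := by
  have hσ := sg_pos hs
  have hs0 := hs.1
  rw [norm_smul, norm_inv, Real.norm_of_nonneg hs.1.le, inv_mul_le_iff₀ hs.1, WW_eq hs]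
  refine (norm_Hs_le hL hg hs x).trans (le_of_eq ?_)
  rw [neg_zero, Real.rpow_zero]
  field_simp

lemma WW_integrable {β : ℝ} (h0 : 0 ≤ β) (h1 : β < 1) : Integrable (WW β) mu1 := (WW_int h0 h1).1

lemma int_D {d : ℕ} {g : EuclideanSpace ℝ (Fin d) → ℝ} {L : ℝ} (hL : 0 ≤ L)
    (hg : ∀ x y, |g x - g y| ≤ L * ‖x - y‖) (x : EuclideanSpace ℝ (Fin d)) :
    Integrable (fun s => s⁻¹ • ms g s x) mu1 :=
  Integrable.of_bound (meas_D (continuous_of_lip hg) x) L (ae_mu1 fun _ hs => bound_D hL hg hs x)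

lemma int_H {d : ℕ} {g : EuclideanSpace ℝ (Fin d) → ℝ} {L : ℝ} (hL : 0 ≤ L)
    (hg : ∀ x y, |g x - g y| ≤ L * ‖x - y‖) (x : EuclideanSpace ℝ (Fin d)) :
    Integrable (fun s => s⁻¹ • Hs g s x) mu1 :=
  Integrable.mono' ((WW_integrable le_rfl one_pos).const_mul L) (meas_H (continuous_of_lip hg) x)
    (ae_mu1 fun _ hs => bound_H hL hg hs x)

/-- Minus the Stein solution. -/
def F0 {d : ℕ} (g : EuclideanSpace ℝ (Fin d) → ℝ) (x : EuclideanSpace ℝ (Fin d)) : ℝ :=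
  ∫ s, s⁻¹ * (Gs g s x - ∫ z, g z ∂(gam d)) ∂mu1

/-- Its gradient. -/
def D0 {d : ℕ} (g : EuclideanSpace ℝ (Fin d) → ℝ) (x : EuclideanSpace ℝ (Fin d)) :
    EuclideanSpace ℝ (Fin d) := ∫ s, s⁻¹ • ms g s x ∂mu1

/-- Its Hessian. -/
def H0 {d : ℕ} (g : EuclideanSpace ℝ (Fin d) → ℝ) (x : EuclideanSpace ℝ (Fin d)) :
    EuclideanSpace ℝ (Fin d) →L[ℝ] EuclideanSpace ℝ (Fin d) := ∫ s, s⁻¹ • Hs g s x ∂mu1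

lemma hasFDerivAt_F0 {d : ℕ} {g : EuclideanSpace ℝ (Fin d) → ℝ} {L : ℝ} (hL : 0 ≤ L)
    (hg : ∀ x y, |g x - g y| ≤ L * ‖x - y‖) (x : EuclideanSpace ℝ (Fin d)) :
    HasFDerivAt (F0 g) (innerSL ℝ (D0 g x)) x := by
  have hm : ∀ y, AEStronglyMeasurable (fun s => innerSL ℝ (s⁻¹ • ms g s y)) mu1 := fun y =>
    (innerSL ℝ).continuous.comp_aestronglyMeasurable (meas_D (continuous_of_lip hg) y)
  have h := hasFDerivAt_integral_of_dominated_of_fderiv_le (𝕜 := ℝ) (μ := mu1) (s := Set.univ)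
    (x₀ := x) (F := fun x s => s⁻¹ * (Gs g s x - ∫ z, g z ∂(gam d)))
    (F' := fun x s => innerSL ℝ (s⁻¹ • ms g s x)) (bound := fun _ => L) Filter.univ_mem
    (Filter.Eventually.of_forall fun y => (int_F hL hg y).aestronglyMeasurable)
    (int_F hL hg x) (hm x)
    (ae_mu1 fun s hs y _ => by rw [innerSL_apply_norm]; exact bound_D hL hg hs y)
    (integrable_const _)
    (ae_mu1 fun s hs y _ => by
      refine hfd_congr (((hasFDerivAt_Gs hL hg hs y).sub_const (∫ z, g z ∂(gam d))).const_mul s⁻¹)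
        (fun _ => rfl) fun v => ?_
      simp [inner_smul_left])
  refine hfd_congr h (fun _ => rfl) fun v => ?_
  rw [D0, ← (innerSL ℝ).integral_comp_comm (int_D hL hg x)]

lemma hasFDerivAt_D0 {d : ℕ} {g : EuclideanSpace ℝ (Fin d) → ℝ} {L : ℝ} (hL : 0 ≤ L)
    (hg : ∀ x y, |g x - g y| ≤ L * ‖x - y‖) (x : EuclideanSpace ℝ (Fin d)) :
    HasFDerivAt (D0 g) (H0 g x) x :=
  hasFDerivAt_integral_of_dominated_of_fderiv_le (𝕜 := ℝ) (μ := mu1) (s := Set.univ)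
    (x₀ := x) (F := fun x s => s⁻¹ • ms g s x)
    (F' := fun x s => s⁻¹ • Hs g s x) (bound := fun s => L * WW 0 s) Filter.univ_mem
    (Filter.Eventually.of_forall fun y => meas_D (continuous_of_lip hg) y)
    (int_D hL hg x) (meas_H (continuous_of_lip hg) x)
    (ae_mu1 fun s hs y _ => bound_H hL hg hs y)
    ((WW_integrable le_rfl one_pos).const_mul L)
    (ae_mu1 fun s hs y _ => (hasFDerivAt_ms hL hg hs y).const_smul s⁻¹)

lemma H0_holder {d : ℕ} {g : EuclideanSpace ℝ (Fin d) → ℝ} {L : ℝ} (hL : 0 ≤ L)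
    (hg : ∀ x y, |g x - g y| ≤ L * ‖x - y‖) {β : ℝ}
    (hβ : β ∈ Set.Ioo (0 : ℝ) 1) (x y : EuclideanSpace ℝ (Fin d)) :
    ‖H0 g x - H0 g y‖ ≤ 2 / (1 - β) * ‖x - y‖ ^ β * L := by
  rw [H0, H0, ← integral_sub (int_H hL hg x) (int_H hL hg y)]
  refine (norm_integral_le_of_norm_le ((WW_integrable hβ.1.le hβ.2).const_mul
    (2 * L * ‖x - y‖ ^ β)) (ae_mu1 fun s hs => Hs_holder hL hg hs hβ x y)).trans (le_of_eq ?_)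
  rw [integral_const_mul, show ∫ s, WW β s ∂mu1 = 1 / (1 - β) from (WW_int hβ.1.le hβ.2).2]
  ring

lemma continuous_H0 {d : ℕ} {g : EuclideanSpace ℝ (Fin d) → ℝ} {L : ℝ} (hL : 0 ≤ L)
    (hg : ∀ x y, |g x - g y| ≤ L * ‖x - y‖) : Continuous (H0 g) := by
  rw [continuous_iff_continuousAt]
  intro x
  rw [ContinuousAt, tendsto_iff_norm_sub_tendsto_zero]
  refine squeeze_zero (fun _ => norm_nonneg _)
    (fun y => H0_holder hL hg (β := 1 / 2) (by norm_num) y x) ?_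
  have : Continuous fun y : EuclideanSpace ℝ (Fin d) =>
      2 / (1 - (1 / 2 : ℝ)) * ‖y - x‖ ^ (1 / 2 : ℝ) * L := by
    have : Continuous fun y : EuclideanSpace ℝ (Fin d) => ‖y - x‖ ^ (1 / 2 : ℝ) :=
      Continuous.rpow_const (by fun_prop) fun _ => Or.inr (by norm_num)
    fun_prop
  have h := this.tendsto x
  simpa using h

lemma stein_int {d : ℕ} {g : EuclideanSpace ℝ (Fin d) → ℝ} {L : ℝ} (hL : 0 ≤ L)
    (hg : ∀ x y, |g x - g y| ≤ L * ‖x - y‖) (u : EuclideanSpace ℝ (Fin d)) :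
    trL d (H0 g u) - ⟪u, D0 g u⟫ = -(g u - ∫ z, g z ∂(gam d)) := by
  have hgc := continuous_of_lip hg
  have hc : ContinuousOn (fun s => Gs g s u) (Set.Icc 0 1) := by
    have i1 : Integrable (fun z : EuclideanSpace ℝ (Fin d) => (|g 0| + L * ‖u‖ + L) * (1 + ‖z‖)) (gam d) := by
      refine integrable_gam_of_le (n := 1) (by fun_prop) (|g 0| + L * ‖u‖ + L) fun z => ?_
      rw [Real.norm_of_nonneg (by positivity), pow_one]
    refine continuousOn_of_dominated (bound := fun z => (|g 0| + L * ‖u‖ + L) * (1 + ‖z‖))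
      (fun s _ => ?_) (fun s hs => ?_) i1 ?_
    · exact (by fun_prop : Continuous fun z => g (s • u + sg s • z)).aestronglyMeasurable
    · refine Filter.Eventually.of_forall fun z => (growth hL hg (s • u) z (sg s)).trans ?_
      have h1 : |g (s • u)| ≤ |g 0| + L * ‖u‖ := by
        have a := hg (s • u) 0
        have b := abs_sub_abs_le_abs_sub (g (s • u)) (g 0)
        rw [sub_zero, norm_smul, Real.norm_of_nonneg hs.1] at a
        have : L * (s * ‖u‖) ≤ L * ‖u‖ := by
          gcongr
          exact mul_le_of_le_one_left (norm_nonneg _) hs.2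
        linarith
      have h2 : L * |sg s| ≤ L := by
        rw [abs_of_nonneg (sg_nonneg s)]
        exact mul_le_of_le_one_right hL (sg_le_one s)
      gcongr
    · refine Filter.Eventually.of_forall fun z => ?_
      have := continuous_sg
      exact (by fun_prop : Continuous fun s : ℝ => g (s • u + sg s • z)).continuousOn
  have iT : Integrable (fun s => trL d (s⁻¹ • Hs g s u)) mu1 :=
    (trL d).integrable_comp (int_H hL hg u)
  have iI : Integrable (fun s => innerSL ℝ u (s⁻¹ • ms g s u)) mu1 :=
    (innerSL ℝ u).integrable_comp (int_D hL hg u)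
  have e : ∀ s, -(s⁻¹ * (trL d (Hs g s u) - ⟪u, ms g s u⟫)) =
      -(trL d (s⁻¹ • Hs g s u) - innerSL ℝ u (s⁻¹ • ms g s u)) := by
    intro s
    rw [map_smul, map_smul, innerSL_apply_apply, smul_eq_mul, smul_eq_mul]; ring
  have hI : IntegrableOn (fun s => -(s⁻¹ * (trL d (Hs g s u) - ⟪u, ms g s u⟫)))
      (Set.Ioc 0 1) := by
    rw [integrableOn_Ioc_iff_integrableOn_Ioo]
    simp_rw [e]
    exact (iT.sub iI).neg
  have h := intervalIntegral.integral_eq_sub_of_hasDerivAt_of_le zero_le_one hc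
    (fun s hs => hasDerivAt_Gs hL hg hs u)
    ((intervalIntegrable_iff_integrableOn_Ioc_of_le zero_le_one).2 hI)
  rw [intervalIntegral.integral_of_le zero_le_one, integral_Ioc_eq_integral_Ioo] at h
  simp_rw [e] at h
  change ∫ s, -(trL d (s⁻¹ • Hs g s u) - innerSL ℝ u (s⁻¹ • ms g s u)) ∂mu1 = _ at h
  rw [integral_neg, integral_sub iT iI, (trL d).integral_comp_comm (int_H hL hg u),
    (innerSL ℝ u).integral_comp_comm (int_D hL hg u), innerSL_apply_apply] at h
  have g1 : Gs g 1 u = g u := by simp [Gs, sg]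
  have g0 : Gs g 0 u = ∫ z, g z ∂(gam d) := by simp [Gs, sg]
  rw [g1, g0] at h
  rw [← h, neg_neg]; rfl

lemma abs_trL_le {d : ℕ} (A : EuclideanSpace ℝ (Fin d) →L[ℝ] EuclideanSpace ℝ (Fin d)) :
    |trL d A| ≤ d * ‖A‖ := by
  rw [trL_apply]
  refine (Finset.abs_sum_le_sum_abs _ _).trans ?_
  calc _ ≤ ∑ _i : Fin d, ‖A‖ := by
        refine Finset.sum_le_sum fun i _ => ?_
        refine (abs_inner_le' _ _).trans ?_
        have h1 : ‖EuclideanSpace.single i (1 : ℝ)‖ = 1 := by simp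
        have h2 := A.le_opNorm (EuclideanSpace.single i (1 : ℝ))
        rw [h1, mul_one] at h2 ⊢
        exact h2
    _ = _ := by simp

/-- Regularity of the solution of Stein's equation (Lemma 2.1, items (1) and (2)):
for every 1 ≤ d, β ∈ (0,1), L > 0 and L-Lipschitz g : ℝ^d → ℝ there is a C² solution f
of Stein's equation whose Hessian is β-Hölder (in operator norm) with constant C̃₁(d,β)L and
whose Laplacian is β-Hölder with constant C̃₂(d,β)L. -/
theorem stein_regularity (d : ℕ) (hd : 1 ≤ d) (β : ℝ) (hβ : β ∈ Set.Ioo (0:ℝ) 1)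
    (L : ℝ) (hL : 0 < L)
    (g : EuclideanSpace ℝ (Fin d) → ℝ) (hg : ∀ x y, |g x - g y| ≤ L * ‖x - y‖) :
    ∃ f : EuclideanSpace ℝ (Fin d) → ℝ, ContDiff ℝ 2 f ∧
      (∀ u, g u - ∫ z, g z ∂(stdGaussian d) = lap f u - ⟪u, gradient f u⟫) ∧
      (∀ x y, ‖hess f x - hess f y‖ ≤
        ((2:ℝ) ^ ((3:ℝ)/2) * (1 + 2 * d * Real.Gamma ((1 + d) / 2)) / (d * Real.Gamma (d / 2))
          + 2 / (1 - β)) * ‖x - y‖ ^ β * L) ∧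
      (∀ x y, |lap f x - lap f y| ≤
        (2 * Real.sqrt (2 * d / Real.pi) + 2 * d / (1 - β)) * ‖x - y‖ ^ β * L) := by
  have hL0 := hL.le
  have hf : ∀ x, HasFDerivAt (fun y => -F0 g y) (innerSL ℝ (-D0 g x)) x := fun x =>
    hfd_congr (hasFDerivAt_F0 hL0 hg x).neg (fun _ => rfl) fun v => by simp
  have hD : ∀ x, HasFDerivAt (fun y => -D0 g y) (-H0 g x) x := fun x =>
    (hasFDerivAt_D0 hL0 hg x).neg
  have hgrad : ∀ x, gradient (fun y => -F0 g y) x = -D0 g x := fun x => by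
    apply HasGradientAt.gradient
    rw [hasGradientAt_iff_hasFDerivAt]
    exact hfd_congr (hf x) (fun _ => rfl) fun v => by simp
  have hhess : ∀ x, hess (fun y => -F0 g y) x = -H0 g x := fun x => by
    unfold hess
    rw [funext hgrad]
    exact (hD x).fderiv
  have hlap : ∀ x, lap (fun y => -F0 g y) x = -trL d (H0 g x) := fun x => by
    unfold lap
    rw [hhess, ← trL_apply, map_neg]
  have hb : 0 < 1 - β := by linarith [hβ.2]
  have hd0 : (0 : ℝ) < d := by exact_mod_cast hd
  refine ⟨fun y => -F0 g y, ?_, ?_, ?_, ?_⟩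
  · have h1 : ContDiff ℝ 1 (fun y => -D0 g y) :=
      contDiff_one_iff_hasFDerivAt.2 ⟨_, (continuous_H0 hL0 hg).neg, hD⟩
    have h2 : ContDiff ℝ 1 (fun y => innerSL ℝ (-D0 g y)) := (innerSL ℝ).contDiff.comp h1
    have h3 := (contDiff_succ_iff_hasFDerivAt (𝕜 := ℝ) (n := 1) (f := fun y => -F0 g y)).2
      ⟨_, by exact_mod_cast h2, hf⟩
    have e : (2 : WithTop ℕ∞) = ((1 : ℕ) : WithTop ℕ∞) + 1 := by norm_num
    rw [e]; exact h3
  · intro u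
    rw [hlap, hgrad, inner_neg_right, stdGaussian_eq_gam]
    linarith [stein_int hL0 hg u]
  · intro x y
    rw [hhess, hhess, show -H0 g x - -H0 g y = -(H0 g x - H0 g y) by abel, norm_neg]
    refine (H0_holder hL0 hg hβ x y).trans ?_
    have g1 : 0 < Real.Gamma ((1 + d) / 2) := Real.Gamma_pos_of_pos (by positivity)
    have g2 : 0 < Real.Gamma ((d : ℝ) / 2) := Real.Gamma_pos_of_pos (by positivity)
    gcongr
    exact le_add_of_nonneg_left (by positivity)
  · intro x y
    rw [hlap, hlap, show -trL d (H0 g x) - -trL d (H0 g y) = -(trL d (H0 g x) - trL d (H0 g y)) by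
      ring, abs_neg, ← map_sub]
    refine (abs_trL_le _).trans ?_
    calc _ ≤ d * (2 / (1 - β) * ‖x - y‖ ^ β * L) := by
          gcongr
          exact H0_holder hL0 hg hβ x y
      _ = (2 * d / (1 - β)) * ‖x - y‖ ^ β * L := by ring
      _ ≤ _ := by
          gcongr
          exact le_add_of_nonneg_left (by positivity)
end
end

section
/- There exists a universal constant C > 0, independent of the dimension d, of L, and of g, such that for every d ≥ 1, every L > 0 and every L-Lipschitz function g : ℝ^d → ℝ, there is a twice continuously differentiable solution f : ℝ^d → ℝ of Stein's equation g(u) − E[g(Z)] = Δf(u) − uᵀ∇f(u) satisfying ⟨∇²f(x), u₁u₂ᵀ⟩_HS ≤ C · L · ‖u₁‖·‖u₂‖ for all x, u₁, u₂ ∈ ℝ^d. -/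
open MeasureTheory ProbabilityTheory
open scoped BigOperators NNReal ENNReal RealInnerProductSpace Matrix

noncomputable section

namespace SteinAux

open Real

abbrev EE (d : ℕ) := EuclideanSpace ℝ (Fin d)

lemma std_eq (d : ℕ) : _root_.stdGaussian d = ProbabilityTheory.stdGaussian (EE d) := by
  rw [← map_pi_eq_stdGaussian]
  rfl

instance std_gauss (d : ℕ) : IsGaussian (_root_.stdGaussian d) := by
  rw [std_eq]; infer_instance

instance std_prob (d : ℕ) : IsProbabilityMeasure (_root_.stdGaussian d) := by
  rw [std_eq]; infer_instance

/-- density -/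
def dens (d : ℕ) (z : EE d) : ℝ := ((π / (1/2 : ℝ)) ^ ((d : ℝ) / 2))⁻¹ * exp (-(1/2) * ‖z‖ ^ 2)

lemma dens_nonneg (d : ℕ) (z : EE d) : 0 ≤ dens d z := by
  unfold dens; positivity

lemma measurable_dens (d : ℕ) : Measurable (dens d) := by
  unfold dens; fun_prop

lemma integrable_dens (d : ℕ) : Integrable (dens d) := by
  unfold dens
  have h := GaussianFourier.integrable_cexp_neg_mul_sq_norm_add (b := (1/2 : ℂ)) (V := EE d)
    (by norm_num) 0 0
  have h2 := h.re
  refine Integrable.const_mul ?_ _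
  refine h2.congr (ae_of_all _ fun z => ?_)
  simp only [zero_mul, add_zero]
  have : (-(1/2 : ℂ) * (‖z‖ : ℂ) ^ 2) = ((-(1/2) * ‖z‖ ^ 2 : ℝ) : ℂ) := by push_cast; ring
  rw [this, ← Complex.ofReal_exp]; rfl

lemma std_withDensity (d : ℕ) :
    _root_.stdGaussian d = (volume : Measure (EE d)).withDensity (fun z => ENNReal.ofReal (dens d z)) := by
  have : IsFiniteMeasure ((volume : Measure (EE d)).withDensity
      (fun z => ENNReal.ofReal (dens d z))) :=
    isFiniteMeasure_withDensity_ofReal (integrable_dens d).2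
  rw [std_eq]
  refine Measure.ext_of_charFun ?_
  ext t
  rw [charFun_stdGaussian, charFun_apply]
  rw [integral_withDensity_eq_integral_toReal_smul (by have := measurable_dens d; fun_prop) (by simp)]
  have h := GaussianFourier.integral_cexp_neg_mul_sq_norm_add (b := (1/2 : ℂ)) (V := EE d)
    (by norm_num) Complex.I t
  have e : ∀ z : EE d, (ENNReal.ofReal (dens d z)).toReal • Complex.exp (⟪z, t⟫ * Complex.I)
      = (((π / (1/2 : ℝ)) ^ ((d : ℝ) / 2))⁻¹ : ℝ) *
        Complex.exp (-(1/2 : ℂ) * (‖z‖ : ℂ) ^ 2 + Complex.I * (⟪t, z⟫ : ℝ)) := by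
    intro z
    rw [ENNReal.toReal_ofReal (dens_nonneg d z), dens, Complex.exp_add, real_inner_comm]
    rw [Complex.real_smul]
    push_cast
    ring_nf
  simp_rw [e]
  rw [integral_const_mul, h]
  have : ((π : ℂ) / (1/2)) ^ ((Module.finrank ℝ (EE d) : ℂ) / 2)
    = (((π / (1/2 : ℝ)) ^ ((d : ℝ) / 2) : ℝ) : ℂ) := by
    rw [Complex.ofReal_cpow (by positivity)]
    simp
  rw [this, ← mul_assoc, ← Complex.ofReal_mul, inv_mul_cancel₀ (by positivity)]
  simp only [Complex.I_sq]
  push_cast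
  ring_nf

lemma std_ac (d : ℕ) : _root_.stdGaussian d ≪ (volume : Measure (EE d)) := by
  rw [std_withDensity]
  exact withDensity_absolutelyContinuous _ _

lemma integral_std {F : Type*} [NormedAddCommGroup F] [NormedSpace ℝ F] {d : ℕ} (h : EE d → F) :
    ∫ z, h z ∂(_root_.stdGaussian d) = ∫ z, dens d z • h z := by
  rw [std_withDensity,
    integral_withDensity_eq_integral_toReal_smul (by have := measurable_dens d; fun_prop) (by simp)]
  simp [dens_nonneg]

/-- Cameron–Martin. -/
lemma cameron_martin {d : ℕ} (h : EE d → ℝ) (w : EE d) :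
    ∫ z, h (z + w) ∂(_root_.stdGaussian d)
      = ∫ z, h z * exp (⟪w, z⟫ - ‖w‖ ^ 2 / 2) ∂(_root_.stdGaussian d) := by
  rw [integral_std, integral_std,
    ← integral_add_right_eq_self (fun z => dens d z • (h z * exp (⟪w, z⟫ - ‖w‖ ^ 2 / 2))) w]
  congr 1
  ext z
  have : exp (-(1/2) * ‖z‖ ^ 2) = exp (-(1/2) * ‖z + w‖ ^ 2) * exp (⟪w, z + w⟫ - ‖w‖ ^ 2 / 2) := by
    rw [← Real.exp_add, norm_add_sq_real, inner_add_right, real_inner_self_eq_norm_sq,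
      real_inner_comm]
    ring_nf
  simp only [dens, smul_eq_mul]
  rw [this]
  ring

lemma integrable_exp_norm (d : ℕ) (R : ℝ) :
    Integrable (fun z : EE d => exp (R * ‖z‖)) (_root_.stdGaussian d) := by
  obtain ⟨C, hC, hi⟩ := IsGaussian.exists_integrable_exp_sq (_root_.stdGaussian d)
  refine (hi.const_mul (exp (R ^ 2 / (4 * C)))).mono' (by fun_prop) (ae_of_all _ fun z => ?_)
  rw [Real.norm_eq_abs, abs_of_pos (exp_pos _), ← Real.exp_add]
  apply Real.exp_le_exp.2
  have : R ^ 2 / (4 * C) + C * ‖z‖ ^ 2 - R * ‖z‖ = (R - 2 * C * ‖z‖) ^ 2 / (4 * C) := by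
    field_simp; ring
  have h2 : 0 ≤ (R - 2 * C * ‖z‖) ^ 2 / (4 * C) := by positivity
  linarith

lemma lin_le_exp {a b t : ℝ} (ha : 0 ≤ a) (hb : 0 ≤ b) (ht : 0 ≤ t) :
    a + b * t ≤ (a + b) * exp t := by
  have := Real.add_one_le_exp t
  nlinarith [mul_nonneg ha ht, mul_nonneg hb ht]

lemma intg {F : Type*} [NormedAddCommGroup F] {d : ℕ} {Φ : EE d → F}
    (hm : AEStronglyMeasurable Φ (_root_.stdGaussian d)) (C R : ℝ)
    (hb : ∀ z, ‖Φ z‖ ≤ C * exp (R * ‖z‖)) : Integrable Φ (_root_.stdGaussian d) :=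
  ((integrable_exp_norm d R).const_mul C).mono' hm (ae_of_all _ hb)

lemma lipW {d : ℕ} {h : EE d → ℝ} {K : ℝ} (hK : 0 ≤ K)
    (hh : ∀ x y, |h x - h y| ≤ K * ‖x - y‖) : LipschitzWith K.toNNReal h := by
  refine LipschitzWith.of_dist_le_mul fun x y => ?_
  rw [Real.dist_eq, dist_eq_norm, Real.coe_toNNReal _ hK]
  exact hh x y

lemma fderiv_le {d : ℕ} {h : EE d → ℝ} {K : ℝ} (hK : 0 ≤ K)
    (hh : ∀ x y, |h x - h y| ≤ K * ‖x - y‖) (z : EE d) : ‖fderiv ℝ h z‖ ≤ K := by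
  have := norm_fderiv_le_of_lipschitz ℝ (lipW hK hh) (x₀ := z)
  rwa [Real.coe_toNNReal _ hK] at this

lemma growth {d : ℕ} {h : EE d → ℝ} {K : ℝ} (hK : 0 ≤ K)
    (hh : ∀ x y, |h x - h y| ≤ K * ‖x - y‖) (z : EE d) :
    |h z| ≤ (|h 0| + K) * exp ‖z‖ := by
  have h1 := hh z 0
  rw [sub_zero] at h1
  have h2 : |h z| ≤ |h 0| + K * ‖z‖ := by
    have := abs_sub_abs_le_abs_sub (h z) (h 0)
    linarith
  exact h2.trans (lin_le_exp (abs_nonneg _) hK (norm_nonneg _))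

lemma ibp {d : ℕ} {h : EE d → ℝ} {K : ℝ} (hK : 0 ≤ K)
    (hh : ∀ x y, |h x - h y| ≤ K * ‖x - y‖) (a : ℝ) (v w : EE d) :
    ∫ z, fderiv ℝ h z w * (a + ⟪v, z⟫) ∂(_root_.stdGaussian d)
      = ∫ z, h z * ((a + ⟪v, z⟫) * ⟪w, z⟫ - ⟪v, w⟫) ∂(_root_.stdGaussian d) := by
  have hc : Continuous h := (lipW hK hh).continuous
  have kb : ∀ z, |a + ⟪v, z⟫| ≤ (|a| + ‖v‖) * exp ‖z‖ := fun z => by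
    have h1 := abs_add_le a ⟪v, z⟫
    have h2 := abs_real_inner_le_norm v z
    exact (h1.trans (by linarith)).trans
      (lin_le_exp (abs_nonneg a) (norm_nonneg v) (norm_nonneg z))
  have kc : Continuous fun z : EE d => a + ⟪v, z⟫ := by fun_prop
  have hA : HasDerivAt (fun ε : ℝ => ∫ z, h (z + ε • w) * (a + ⟪v, z⟫) ∂(_root_.stdGaussian d))
      (∫ z, fderiv ℝ h z w * (a + ⟪v, z⟫) ∂(_root_.stdGaussian d)) 0 := by
    refine (hasDerivAt_integral_of_dominated_loc_of_lip (s := Set.univ)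
      (bound := fun z => K * ‖w‖ * |a + ⟪v, z⟫|) Filter.univ_mem ?_ ?_ ?_ ?_ ?_ ?_).2
    · exact Filter.Eventually.of_forall fun ε => by fun_prop
    · refine intg (by fun_prop) ((|h 0| + K) * (|a| + ‖v‖)) 2 fun z => ?_
      rw [zero_smul, add_zero, norm_mul, Real.norm_eq_abs, Real.norm_eq_abs, two_mul,
        Real.exp_add]
      calc |h z| * |a + ⟪v, z⟫| ≤ ((|h 0| + K) * exp ‖z‖) * ((|a| + ‖v‖) * exp ‖z‖) :=
            mul_le_mul (growth hK hh z) (kb z) (abs_nonneg _) (by positivity)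
        _ = _ := by ring
    · refine (Measurable.mul ?_ kc.measurable).aestronglyMeasurable
      exact measurable_fderiv_apply_const ℝ h w
    · refine ae_of_all _ fun z => LipschitzOnWith.of_dist_le_mul fun x _ y _ => ?_
      have hnn : 0 ≤ K * ‖w‖ * |a + ⟪v, z⟫| := by positivity
      rw [Real.dist_eq, Real.dist_eq, ← sub_mul, abs_mul, Real.coe_nnabs, abs_of_nonneg hnn]
      have := hh (z + x • w) (z + y • w)
      rw [add_sub_add_left_eq_sub, ← sub_smul, norm_smul, Real.norm_eq_abs] at this
      nlinarith [abs_nonneg (a + ⟪v, z⟫)]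
    · refine intg (by fun_prop) (K * ‖w‖ * (|a| + ‖v‖)) 1 fun z => ?_
      rw [Real.norm_eq_abs, abs_of_nonneg (by positivity), one_mul, mul_assoc _ _ (exp _)]
      exact mul_le_mul_of_nonneg_left (kb z) (by positivity)
    · have := (std_ac d).ae_le ((lipW hK hh).ae_differentiableAt (μ := volume))
      filter_upwards [this] with z hz
      refine HasDerivAt.mul_const ?_ _
      have h1 : HasDerivAt (fun ε : ℝ => z + ε • w) w 0 := by
        simpa using ((hasDerivAt_id (0:ℝ)).smul_const w).const_add z
      have hz' : HasFDerivAt h (fderiv ℝ h z) (z + (0:ℝ) • w) := by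
        simpa using hz.hasFDerivAt
      exact hz'.comp_hasDerivAt (0:ℝ) h1
  have hB : HasDerivAt (fun ε : ℝ => ∫ z, h z * ((a + ⟪v, z - ε • w⟫) *
        exp (ε * ⟪w, z⟫ - ε ^ 2 * ‖w‖ ^ 2 / 2)) ∂(_root_.stdGaussian d))
      (∫ z, h z * ((-⟪v, w⟫) * exp (0 * ⟪w, z⟫ - 0 ^ 2 * ‖w‖ ^ 2 / 2) +
        (a + ⟪v, z - (0:ℝ) • w⟫) * (exp (0 * ⟪w, z⟫ - 0 ^ 2 * ‖w‖ ^ 2 / 2) *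
          (⟪w, z⟫ - 0 * ‖w‖ ^ 2))) ∂(_root_.stdGaussian d)) 0 := by
    have eb : ∀ z : EE d, ∀ ε ∈ Metric.ball (0:ℝ) 1,
        exp (ε * ⟪w, z⟫ - ε ^ 2 * ‖w‖ ^ 2 / 2) ≤ exp (‖w‖ * ‖z‖) := by
      intro z ε hε
      rw [mem_ball_zero_iff, Real.norm_eq_abs] at hε
      apply Real.exp_le_exp.2
      have h1 : ε * ⟪w, z⟫ ≤ ‖w‖ * ‖z‖ := by
        calc ε * ⟪w, z⟫ ≤ |ε * ⟪w, z⟫| := le_abs_self _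
          _ = |ε| * |⟪w, z⟫| := abs_mul _ _
          _ ≤ 1 * (‖w‖ * ‖z‖) := mul_le_mul hε.le (abs_real_inner_le_norm _ _)
              (abs_nonneg _) zero_le_one
          _ = _ := one_mul _
      have : 0 ≤ ε ^ 2 * ‖w‖ ^ 2 / 2 := by positivity
      linarith
    refine (hasDerivAt_integral_of_dominated_loc_of_deriv_le (s := Metric.ball 0 1)
      (F' := fun ε z => h z * ((-⟪v, w⟫) * exp (ε * ⟪w, z⟫ - ε ^ 2 * ‖w‖ ^ 2 / 2) +
        (a + ⟪v, z - ε • w⟫) * (exp (ε * ⟪w, z⟫ - ε ^ 2 * ‖w‖ ^ 2 / 2) *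
          (⟪w, z⟫ - ε * ‖w‖ ^ 2))))
      (bound := fun z => ((|h 0| + K) * (‖v‖ * ‖w‖ + (|a| + ‖v‖ * ‖w‖ + ‖v‖) * (‖w‖ ^ 2 + ‖w‖))) *
        exp ((3 + ‖w‖) * ‖z‖))
      (Metric.ball_mem_nhds 0 one_pos) ?_ ?_ ?_ ?_ ?_ ?_).2
    · exact Filter.Eventually.of_forall fun ε => by fun_prop
    · refine intg (by fun_prop) ((|h 0| + K) * (|a| + ‖v‖)) 2 fun z => ?_
      simp only [zero_smul, sub_zero, zero_mul, ne_eq, OfNat.ofNat_ne_zero, not_false_eq_true,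
        zero_pow, zero_div, Real.exp_zero, mul_one]
      rw [norm_mul, Real.norm_eq_abs, Real.norm_eq_abs, two_mul,
        Real.exp_add]
      calc |h z| * |a + ⟪v, z⟫| ≤ ((|h 0| + K) * exp ‖z‖) * ((|a| + ‖v‖) * exp ‖z‖) :=
            mul_le_mul (growth hK hh z) (kb z) (abs_nonneg _) (by positivity)
        _ = _ := by ring
    · fun_prop
    · refine ae_of_all _ fun z ε hε => ?_
      have he := eb z ε hε
      rw [mem_ball_zero_iff, Real.norm_eq_abs] at hε
      set e := exp (ε * ⟪w, z⟫ - ε ^ 2 * ‖w‖ ^ 2 / 2) with he_def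
      have epos : 0 < e := exp_pos _
      have b1 : |a + ⟪v, z - ε • w⟫| ≤ (|a| + ‖v‖ * ‖w‖ + ‖v‖) * exp ‖z‖ := by
        have h2 := abs_real_inner_le_norm v (z - ε • w)
        have h3 : ‖z - ε • w‖ ≤ ‖z‖ + ‖w‖ := by
          refine (norm_sub_le _ _).trans ?_
          rw [norm_smul, Real.norm_eq_abs]
          nlinarith [norm_nonneg w]
        have h4 : ‖v‖ * ‖z - ε • w‖ ≤ ‖v‖ * (‖z‖ + ‖w‖) :=
          mul_le_mul_of_nonneg_left h3 (norm_nonneg v)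
        have h1 := abs_add_le a ⟪v, z - ε • w⟫
        exact (h1.trans (by linarith)).trans
          (lin_le_exp (a := |a| + ‖v‖ * ‖w‖) (by positivity) (norm_nonneg v) (norm_nonneg z))
      have b2 : |⟪w, z⟫ - ε * ‖w‖ ^ 2| ≤ (‖w‖ ^ 2 + ‖w‖) * exp ‖z‖ := by
        have h1 := abs_sub ⟪w, z⟫ (ε * ‖w‖ ^ 2)
        have h2 := abs_real_inner_le_norm w z
        have h3 : |ε * ‖w‖ ^ 2| ≤ ‖w‖ ^ 2 := by
          rw [abs_mul, abs_of_nonneg (sq_nonneg ‖w‖)]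
          nlinarith [sq_nonneg ‖w‖]
        exact (h1.trans (by linarith)).trans
          (lin_le_exp (a := ‖w‖ ^ 2) (by positivity) (norm_nonneg w) (norm_nonneg z))
      have b3 : |⟪v, w⟫| ≤ ‖v‖ * ‖w‖ := abs_real_inner_le_norm v w
      have ez : 1 ≤ exp ‖z‖ := Real.one_le_exp (norm_nonneg z)
      rw [Real.norm_eq_abs, abs_mul]
      have b4 : |-⟪v, w⟫ * e + (a + ⟪v, z - ε • w⟫) * (e * (⟪w, z⟫ - ε * ‖w‖ ^ 2))| ≤
          (‖v‖ * ‖w‖ + (|a| + ‖v‖ * ‖w‖ + ‖v‖) * (‖w‖ ^ 2 + ‖w‖)) *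
            (exp ‖z‖ * exp ‖z‖ * exp (‖w‖ * ‖z‖)) := by
        have c1 : |-⟪v, w⟫ * e| ≤ ‖v‖ * ‖w‖ * (exp ‖z‖ * exp ‖z‖ * exp (‖w‖ * ‖z‖)) := by
          rw [abs_mul, abs_neg, abs_of_pos epos]
          refine mul_le_mul b3 (he.trans ?_) epos.le (by positivity)
          exact le_mul_of_one_le_left (exp_pos _).le (by nlinarith)
        have c2 : |(a + ⟪v, z - ε • w⟫) * (e * (⟪w, z⟫ - ε * ‖w‖ ^ 2))| ≤
            ((|a| + ‖v‖ * ‖w‖ + ‖v‖) * exp ‖z‖) *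
              (exp (‖w‖ * ‖z‖) * ((‖w‖ ^ 2 + ‖w‖) * exp ‖z‖)) := by
          rw [abs_mul, abs_mul, abs_of_pos epos]
          exact mul_le_mul b1 (mul_le_mul he b2 (abs_nonneg _) (exp_pos _).le) (by positivity)
            (by positivity)
        refine (abs_add_le _ _).trans ((add_le_add c1 c2).trans (le_of_eq ?_))
        ring
      refine (mul_le_mul (growth hK hh z) b4 (abs_nonneg _) (by positivity)).trans (le_of_eq ?_)
      have : (3 + ‖w‖) * ‖z‖ = ‖z‖ + (‖z‖ + ‖z‖ + ‖w‖ * ‖z‖) := by ring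
      rw [this, Real.exp_add, Real.exp_add, Real.exp_add]
      ring
    · exact (integrable_exp_norm d _).const_mul _
    · refine ae_of_all _ fun z ε _ => ?_
      refine HasDerivAt.const_mul _ ?_
      have d1 : HasDerivAt (fun ε : ℝ => a + ⟪v, z - ε • w⟫) (-⟪v, w⟫) ε := by
        have : (fun ε : ℝ => a + ⟪v, z - ε • w⟫) = fun ε => a + (⟪v, z⟫ - ε * ⟪v, w⟫) := by
          ext ε; rw [inner_sub_right, inner_smul_right]
        rw [this]
        simpa using (((hasDerivAt_id ε).mul_const ⟪v, w⟫).const_sub ⟪v, z⟫).const_add a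
      have d2 : HasDerivAt (fun ε : ℝ => ε * ⟪w, z⟫ - ε ^ 2 * ‖w‖ ^ 2 / 2)
          (⟪w, z⟫ - ε * ‖w‖ ^ 2) ε := by
        have := ((hasDerivAt_id ε).mul_const ⟪w, z⟫).sub
          ((((hasDerivAt_id ε).pow 2).mul_const (‖w‖ ^ 2)).div_const 2)
        convert! this using 1
        simp
        ring
      exact d1.mul d2.exp
  have hAB : (fun ε : ℝ => ∫ z, h (z + ε • w) * (a + ⟪v, z⟫) ∂(_root_.stdGaussian d)) =
      (fun ε : ℝ => ∫ z, h z * ((a + ⟪v, z - ε • w⟫) *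
        exp (ε * ⟪w, z⟫ - ε ^ 2 * ‖w‖ ^ 2 / 2)) ∂(_root_.stdGaussian d)) := by
    ext ε
    have := cameron_martin (fun y => h y * (a + ⟪v, y - ε • w⟫)) (ε • w)
    simp only [add_sub_cancel_right] at this
    rw [this]
    congr 1
    ext z
    rw [inner_smul_left, norm_smul, mul_pow, Real.norm_eq_abs, sq_abs]
    simp [mul_assoc]
  rw [hAB] at hA
  rw [hA.unique hB]
  congr 1
  ext z
  simp
  ring_nf
  try tauto

lemma second_moment {d : ℕ} (v w : EE d) :
    ∫ z, ⟪v, z⟫ * ⟪w, z⟫ ∂(_root_.stdGaussian d) = ⟪v, w⟫ := by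
  have hv : ∀ x y : EE d, |⟪v, x⟫ - ⟪v, y⟫| ≤ ‖v‖ * ‖x - y‖ := fun x y => by
    rw [← inner_sub_right]; exact abs_real_inner_le_norm _ _
  have := ibp (norm_nonneg v) hv 1 0 w
  have hf : ∀ z, fderiv ℝ (fun z => ⟪v, z⟫) z w = ⟪v, w⟫ := fun z => by
    rw [show (fun z => ⟪v, z⟫) = (innerSL ℝ v : EE d → ℝ) from rfl,
      ContinuousLinearMap.fderiv]; rfl
  simp only [inner_zero_left, add_zero, mul_one, hf, one_mul, sub_zero, integral_const,
    smul_eq_mul] at this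
  simpa using this.symm

lemma first_moment {d : ℕ} (v : EE d) :
    ∫ z, |⟪v, z⟫| ∂(_root_.stdGaussian d) ≤ ‖v‖ := by
  have hInt : Integrable (fun z => |⟪v, z⟫|) (_root_.stdGaussian d) := by
    refine intg (by fun_prop) (0 + ‖v‖) 1 fun z => ?_
    rw [Real.norm_eq_abs, abs_abs, one_mul]
    refine (abs_real_inner_le_norm v z).trans ?_
    have := lin_le_exp le_rfl (norm_nonneg v) (norm_nonneg z)
    linarith
  have hInt2 : Integrable (fun z => ⟪v, z⟫ * ⟪v, z⟫) (_root_.stdGaussian d) := by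
    refine intg (by fun_prop) (‖v‖ * ‖v‖) 2 fun z => ?_
    have h1 : |⟪v, z⟫| ≤ ‖v‖ * exp ‖z‖ := by
      refine (abs_real_inner_le_norm v z).trans ?_
      have := lin_le_exp le_rfl (norm_nonneg v) (norm_nonneg z)
      linarith
    rw [norm_mul, Real.norm_eq_abs, two_mul, Real.exp_add]
    refine (mul_le_mul h1 h1 (abs_nonneg _) (by positivity)).trans (le_of_eq (by ring))
  have hm := second_moment v v
  rw [real_inner_self_eq_norm_sq] at hm
  set m := ∫ z, |⟪v, z⟫| ∂(_root_.stdGaussian d) with hmdef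
  have hnn : 0 ≤ ∫ z, (|⟪v, z⟫| - m) ^ 2 ∂(_root_.stdGaussian d) :=
    integral_nonneg fun z => sq_nonneg _
  have e : (fun z : EE d => (|⟪v, z⟫| - m) ^ 2) =
      fun z => ⟪v, z⟫ * ⟪v, z⟫ - (2 * m) * |⟪v, z⟫| + m ^ 2 := by
    ext z
    nlinarith [sq_abs ⟪v, z⟫]
  have hInt3 : Integrable (fun z => ⟪v, z⟫ * ⟪v, z⟫ - (2 * m) * |⟪v, z⟫|)
    (_root_.stdGaussian d) := hInt2.sub (hInt.const_mul _)
  rw [e, integral_add hInt3 (integrable_const _),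
    integral_sub hInt2 (hInt.const_mul _), integral_const_mul, ← hmdef, hm] at hnn
  simp at hnn
  have : m ^ 2 ≤ ‖v‖ ^ 2 := by nlinarith
  exact le_of_sq_le_sq this (norm_nonneg v)

/-- The angle measure times the Gaussian. -/
def mu (d : ℕ) : Measure (ℝ × EE d) :=
  (volume.restrict (Set.Ioo 0 (π / 2))).prod (_root_.stdGaussian d)

instance mu_finite (d : ℕ) : IsFiniteMeasure (mu d) := by
  unfold mu; infer_instance

lemma mu_mem (d : ℕ) : ∀ᵐ p ∂(mu d), p.1 ∈ Set.Ioo 0 (π / 2) :=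
  Measure.quasiMeasurePreserving_fst.ae (ae_restrict_mem measurableSet_Ioo)

lemma intgP {F : Type*} [NormedAddCommGroup F] {d : ℕ} {Φ : ℝ × EE d → F}
    (hm : AEStronglyMeasurable Φ (mu d)) (C R : ℝ)
    (hb : ∀ p : ℝ × EE d, p.1 ∈ Set.Ioo 0 (π / 2) → ‖Φ p‖ ≤ C * exp (R * ‖p.2‖)) :
    Integrable Φ (mu d) := by
  have h : Integrable (fun p : ℝ × EE d => exp (R * ‖p.2‖)) (mu d) :=
    (integrable_exp_norm d R).comp_snd _
  refine (h.const_mul C).mono' hm ?_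
  filter_upwards [mu_mem d] with p hp using hb p hp

lemma lip_slice {d : ℕ} {g : EE d → ℝ} {L : ℝ} 
    (hg : ∀ x y, |g x - g y| ≤ L * ‖x - y‖) (a : EE d) {s : ℝ} (hs : 0 ≤ s) (b : ℝ) (x y : EE d) :
    |(g (a + s • x) - b) - (g (a + s • y) - b)| ≤ L * s * ‖x - y‖ := by
  have := hg (a + s • x) (a + s • y)
  rw [add_sub_add_left_eq_sub, ← smul_sub, norm_smul, Real.norm_eq_abs, abs_of_nonneg hs] at this
  rw [sub_sub_sub_cancel_right]
  linarith

lemma ae_diff_slice {d : ℕ} {g : EE d → ℝ} {L : ℝ} (hL : 0 ≤ L)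
    (hg : ∀ x y, |g x - g y| ≤ L * ‖x - y‖) (a : EE d) {s : ℝ} (hs : 0 < s) :
    ∀ᵐ z ∂(_root_.stdGaussian d), DifferentiableAt ℝ g (a + s • z) := by
  have hl := lipW (K := L * s) (by positivity) (lip_slice hg a hs.le 0)
  filter_upwards [(std_ac d).ae_le (hl.ae_differentiableAt (μ := volume))] with z hz
  have e : g = (fun z => g (a + s • z) - 0) ∘ (fun y => s⁻¹ • (y - a)) := by
    ext y
    simp [smul_inv_smul₀ hs.ne']
  rw [e]
  refine DifferentiableAt.comp _ ?_ (by fun_prop)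
  simpa [inv_smul_smul₀ hs.ne'] using hz

lemma sin_pos' {θ : ℝ} (h : θ ∈ Set.Ioo 0 (π / 2)) : 0 < sin θ :=
  Real.sin_pos_of_pos_of_lt_pi h.1 (by linarith [h.2, Real.pi_pos])

lemma cos_pos' {θ : ℝ} (h : θ ∈ Set.Ioo 0 (π / 2)) : 0 < cos θ :=
  Real.cos_pos_of_mem_Ioo ⟨by linarith [h.1, Real.pi_pos], h.2⟩

lemma ae_diff {d : ℕ} {g : EE d → ℝ} {L : ℝ} (hL : 0 ≤ L)
    (hg : ∀ x y, |g x - g y| ≤ L * ‖x - y‖) (x : EE d) :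
    ∀ᵐ p ∂(mu d), DifferentiableAt ℝ g (cos p.1 • x + sin p.1 • p.2) := by
  unfold mu
  rw [Measure.ae_prod_iff_ae_ae]
  · filter_upwards [ae_restrict_mem measurableSet_Ioo] with θ hθ
    exact ae_diff_slice hL hg _ (sin_pos' hθ)
  · have hm : Measurable fun p : ℝ × EE d => cos p.1 • x + sin p.1 • p.2 := by fun_prop
    exact hm (measurableSet_of_differentiableAt ℝ g)

/-- Gaussian integration by parts on a slice. -/
lemma ibp_slice {d : ℕ} {g : EE d → ℝ} {L : ℝ} (hL : 0 ≤ L)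
    (hg : ∀ x y, |g x - g y| ≤ L * ‖x - y‖) (a : EE d) {s : ℝ} (hs : 0 < s) (b α : ℝ)
    (v w : EE d) :
    ∫ z, (s * fderiv ℝ g (a + s • z) w) * (α + ⟪v, z⟫) ∂(_root_.stdGaussian d)
      = ∫ z, (g (a + s • z) - b) * ((α + ⟪v, z⟫) * ⟪w, z⟫ - ⟪v, w⟫) ∂(_root_.stdGaussian d) := by
  rw [← ibp (h := fun z => g (a + s • z) - b) (K := L * s) (by positivity)
    (lip_slice hg a hs.le b) α v w]
  refine integral_congr_ae ?_
  filter_upwards [ae_diff_slice hL hg a hs] with z hz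
  congr 1
  have h1 : HasFDerivAt (fun z : EE d => a + s • z) (s • ContinuousLinearMap.id ℝ (EE d)) z :=
    ((hasFDerivAt_id z).const_smul s).const_add a
  have h2 := (hz.hasFDerivAt.comp z h1).sub_const b
  have h3 := h2.fderiv
  rw [show (fun z => g (a + s • z) - b) = fun x => (g ∘ fun z => a + s • z) x - b from rfl, h3]
  simp

section main

variable {d : ℕ} {g : EE d → ℝ} {L : ℝ}

/-- The interpolation point. -/
def pt (x : EE d) (p : ℝ × EE d) : EE d := cos p.1 • x + sin p.1 • p.2

lemma cont_pt (x : EE d) : Continuous (pt x) := by unfold pt; fun_prop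

lemma meas_D (g : EE d → ℝ) (x : EE d) : Measurable fun p => fderiv ℝ g (pt x p) :=
  (measurable_fderiv ℝ g).comp (cont_pt x).measurable

lemma pt_sub (x y : EE d) (p : ℝ × EE d) : pt x p - pt y p = cos p.1 • (x - y) := by
  unfold pt; rw [add_sub_add_right_eq_sub, smul_sub]

lemma pt_hasFDerivAt (x : EE d) (p : ℝ × EE d) :
    HasFDerivAt (fun x => pt x p) (cos p.1 • ContinuousLinearMap.id ℝ (EE d)) x :=
  ((hasFDerivAt_id x).const_smul (cos p.1)).add_const _

lemma g_lip_pt (hg : ∀ x y, |g x - g y| ≤ L * ‖x - y‖) (x y : EE d) {p : ℝ × EE d}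
    (hp : p.1 ∈ Set.Ioo 0 (π / 2)) :
    |g (pt x p) - g (pt y p)| ≤ L * (cos p.1 * ‖x - y‖) := by
  have := hg (pt x p) (pt y p)
  rwa [pt_sub, norm_smul, Real.norm_eq_abs, abs_of_pos (cos_pos' hp)] at this

lemma norm_pt_le (x : EE d) (p : ℝ × EE d) : ‖pt x p‖ ≤ ‖x‖ + ‖p.2‖ := by
  unfold pt
  refine (norm_add_le _ _).trans ?_
  rw [norm_smul, norm_smul]
  have h1 := Real.abs_cos_le_one p.1
  have h2 := Real.abs_sin_le_one p.1
  exact add_le_add (mul_le_of_le_one_left (norm_nonneg _) h1)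
    (mul_le_of_le_one_left (norm_nonneg _) h2)

lemma g_pt_growth (hL : 0 ≤ L) (hg : ∀ x y, |g x - g y| ≤ L * ‖x - y‖) (x : EE d) (p : ℝ × EE d) :
    |g (pt x p)| ≤ ((|g 0| + L) * exp ‖x‖) * exp ‖p.2‖ := by
  refine (growth hL hg _).trans ?_
  rw [mul_assoc, ← Real.exp_add]
  exact mul_le_mul_of_nonneg_left (Real.exp_le_exp.2 (norm_pt_le x p)) (by positivity)

/-- The solution. -/
def sol (g : EE d → ℝ) (x : EE d) : ℝ := -∫ p, tan p.1 * (g (pt x p) - g (pt 0 p)) ∂(mu d)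

/-- Its gradient. -/
def solG (g : EE d → ℝ) (x : EE d) : EE d := -∫ p, g (pt x p) • p.2 ∂(mu d)

/-- Its Hessian. -/
def solH (g : EE d → ℝ) (x : EE d) : EE d →L[ℝ] EE d :=
  -∫ p, (cos p.1 • fderiv ℝ g (pt x p)).smulRight p.2 ∂(mu d)

lemma sol_hasFDerivAt (hL : 0 ≤ L) (hg : ∀ x y, |g x - g y| ≤ L * ‖x - y‖) (x : EE d) :
    Integrable (fun p => sin p.1 • fderiv ℝ g (pt x p)) (mu d) ∧
    HasFDerivAt (sol g) (-∫ p, sin p.1 • fderiv ℝ g (pt x p) ∂(mu d)) x := by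
  have gc : Continuous g := (lipW hL hg).continuous
  have tm : Measurable tan := by
    have : tan = fun x => sin x / cos x := by ext x; exact Real.tan_eq_sin_div_cos x
    rw [this]; fun_prop
  have hmeas : ∀ y : EE d, AEStronglyMeasurable
      (fun p : ℝ × EE d => tan p.1 * (g (pt y p) - g (pt 0 p))) (mu d) := fun y =>
    ((tm.comp measurable_fst).mul ((gc.comp (cont_pt y)).sub
      (gc.comp (cont_pt 0))).measurable).aestronglyMeasurable
  have hlip : ∀ y y' : EE d, ∀ p : ℝ × EE d, p.1 ∈ Set.Ioo 0 (π / 2) →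
      |tan p.1 * (g (pt y p) - g (pt y' p))| ≤ L * ‖y - y'‖ := by
    intro y y' p hp
    have hc := cos_pos' hp
    have hs := sin_pos' hp
    have hs1 := Real.sin_le_one p.1
    have h := g_lip_pt hg y y' hp
    rw [abs_mul, Real.tan_eq_sin_div_cos, abs_of_pos (div_pos hs hc)]
    calc sin p.1 / cos p.1 * |g (pt y p) - g (pt y' p)| ≤
        sin p.1 / cos p.1 * (L * (cos p.1 * ‖y - y'‖)) :=
          mul_le_mul_of_nonneg_left h (div_pos hs hc).le
      _ = sin p.1 * (L * ‖y - y'‖) := by field_simp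
      _ ≤ L * ‖y - y'‖ := mul_le_of_le_one_left (by positivity) hs1
  have key := hasFDerivAt_integral_of_dominated_loc_of_lip' (μ := mu d) (s := Set.univ) (x₀ := x)
    (F := fun y p => tan p.1 * (g (pt y p) - g (pt 0 p)))
    (F' := fun p => sin p.1 • fderiv ℝ g (pt x p)) (bound := fun _ => L)
    Filter.univ_mem (fun y _ => hmeas y) ?_ ?_ ?_ (integrable_const _) ?_
  · exact ⟨key.1, key.2.neg⟩
  · refine intgP (hmeas x) (L * ‖x - 0‖) 0 fun p hp => ?_
    simpa using hlip x 0 p hp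
  · exact ((by fun_prop : Measurable fun p : ℝ × EE d => sin p.1).smul
      (meas_D g x)).aestronglyMeasurable
  · filter_upwards [mu_mem d] with p hp y _
    have := hlip y x p hp
    rw [Real.norm_eq_abs, ← mul_sub, sub_sub_sub_cancel_right]
    exact this
  · filter_upwards [mu_mem d, ae_diff hL hg x] with p hp hd
    have hc := cos_pos' hp
    have h1 := (((HasFDerivAt.comp x (f := fun x => pt x p) hd.hasFDerivAt
      (pt_hasFDerivAt x p)).sub_const (g (pt 0 p))).const_mul (tan p.1))
    refine h1.congr_fderiv ?_
    ext v
    simp [Real.tan_eq_sin_div_cos]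
    field_simp
    rfl

lemma intg_grad (hL : 0 ≤ L) (hg : ∀ x y, |g x - g y| ≤ L * ‖x - y‖) (x : EE d) :
    Integrable (fun p => g (pt x p) • p.2) (mu d) := by
  have gc : Continuous g := (lipW hL hg).continuous
  refine intgP ((gc.comp (cont_pt x)).smul continuous_snd).aestronglyMeasurable
    ((|g 0| + L) * exp ‖x‖) 2 fun p hp => ?_
  rw [norm_smul, Real.norm_eq_abs, two_mul, Real.exp_add, ← mul_assoc]
  exact mul_le_mul (g_pt_growth hL hg x p) (by linarith [Real.add_one_le_exp ‖p.2‖])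
    (norm_nonneg _) (by positivity)

lemma solG_hasFDerivAt (hL : 0 ≤ L) (hg : ∀ x y, |g x - g y| ≤ L * ‖x - y‖) (x : EE d) :
    Integrable (fun p : ℝ × EE d => (cos p.1 • fderiv ℝ g (pt x p)).smulRight p.2) (mu d) ∧
    HasFDerivAt (solG g) (solH g x) x := by
  have gc : Continuous g := (lipW hL hg).continuous
  have key := hasFDerivAt_integral_of_dominated_loc_of_lip' (μ := mu d) (s := Set.univ) (x₀ := x)
    (F := fun y p => g (pt y p) • p.2)
    (F' := fun p => (cos p.1 • fderiv ℝ g (pt x p)).smulRight p.2)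
    (bound := fun p => L * ‖p.2‖)
    Filter.univ_mem (fun y _ => (intg_grad hL hg y).1) (intg_grad hL hg x) ?_ ?_ ?_ ?_
  · exact ⟨key.1, key.2.neg⟩
  · have h1 : Measurable fun p : ℝ × EE d => cos p.1 • fderiv ℝ g (pt x p) :=
      (by fun_prop : Measurable fun p : ℝ × EE d => cos p.1).smul (meas_D g x)
    have hc : Continuous fun q : (EE d →L[ℝ] ℝ) × EE d => q.1.smulRight q.2 := by
      fun_prop
    exact (hc.measurable.comp (h1.prodMk measurable_snd)).aestronglyMeasurable
  · filter_upwards [mu_mem d] with p hp y _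
    rw [← sub_smul, norm_smul, Real.norm_eq_abs]
    have h := g_lip_pt hg y x hp
    have : L * (cos p.1 * ‖y - x‖) ≤ L * ‖y - x‖ :=
      mul_le_mul_of_nonneg_left
        (mul_le_of_le_one_left (norm_nonneg _) (Real.cos_le_one _)) hL
    nlinarith [norm_nonneg p.2]
  · refine intgP (by fun_prop) L 1 fun p hp => ?_
    rw [norm_mul, norm_norm, Real.norm_eq_abs, abs_of_nonneg hL, one_mul]
    exact mul_le_mul_of_nonneg_left (by linarith [Real.add_one_le_exp ‖p.2‖]) hL
  · filter_upwards [mu_mem d, ae_diff hL hg x] with p hp hd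
    have h1 := ((HasFDerivAt.comp x (f := fun x => pt x p) hd.hasFDerivAt
      (pt_hasFDerivAt x p)).smul_const p.2)
    refine h1.congr_fderiv ?_
    ext v
    simp
    exact Or.inl (Or.inl rfl)

lemma D_le (hL : 0 ≤ L) (hg : ∀ x y, |g x - g y| ≤ L * ‖x - y‖) (y v : EE d) :
    |fderiv ℝ g y v| ≤ L * ‖v‖ := by
  rw [← Real.norm_eq_abs]
  exact ((fderiv ℝ g y).le_opNorm v).trans
    (mul_le_mul_of_nonneg_right (fderiv_le hL hg y) (norm_nonneg v))

lemma sol_hasGradientAt (hL : 0 ≤ L) (hg : ∀ x y, |g x - g y| ≤ L * ‖x - y‖) (x : EE d) :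
    HasGradientAt (sol g) (solG g x) x := by
  obtain ⟨hi, hd⟩ := sol_hasFDerivAt hL hg x
  rw [hasGradientAt_iff_hasFDerivAt]
  refine hd.congr_fderiv ?_
  ext v
  rw [InnerProductSpace.toDual_apply_apply, solG, inner_neg_left, neg_apply,
    ContinuousLinearMap.integral_apply hi, real_inner_comm, ← integral_inner (intg_grad hL hg x)]
  congr 1
  have i1 : Integrable (fun p => (sin p.1 • fderiv ℝ g (pt x p)) v) (mu d) :=
    hi.apply_continuousLinearMap v
  have i2 : Integrable (fun p => ⟪v, g (pt x p) • p.2⟫) (mu d) :=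
    (intg_grad hL hg x).const_inner v
  unfold mu at i1 i2 ⊢
  rw [integral_prod _ i1, integral_prod _ i2]
  refine setIntegral_congr_fun measurableSet_Ioo fun θ hθ => ?_
  have := ibp_slice hL hg (cos θ • x) (sin_pos' hθ) 0 1 0 v
  simp only [inner_zero_left, add_zero, mul_one, one_mul, sub_zero] at this
  simp only [inner_smul_right]
  exact this

lemma inner_solH (hL : 0 ≤ L) (hg : ∀ x y, |g x - g y| ≤ L * ‖x - y‖) (x v w : EE d) :
    Integrable (fun p : ℝ × EE d => cos p.1 * fderiv ℝ g (pt x p) v * ⟪w, p.2⟫) (mu d) ∧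
    ⟪w, solH g x v⟫ = -∫ p, cos p.1 * fderiv ℝ g (pt x p) v * ⟪w, p.2⟫ ∂(mu d) := by
  have hi := (solG_hasFDerivAt hL hg x).1
  have i1 := hi.apply_continuousLinearMap v
  have i2 := i1.const_inner (𝕜 := ℝ) w
  have e : (fun p : ℝ × EE d => ⟪w, ((cos p.1 • fderiv ℝ g (pt x p)).smulRight p.2) v⟫) =
      fun p : ℝ × EE d => cos p.1 * fderiv ℝ g (pt x p) v * ⟪w, p.2⟫ := by
    ext p
    simp [inner_smul_right]
  rw [e] at i2
  refine ⟨i2, ?_⟩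
  rw [solH, neg_apply, inner_neg_right, ContinuousLinearMap.integral_apply hi,
    ← integral_inner i1, e]

lemma hess_integrand_bound (hL : 0 ≤ L) (hg : ∀ x y, |g x - g y| ≤ L * ‖x - y‖) (x v w : EE d)
    (p : ℝ × EE d) (hp : p.1 ∈ Set.Ioo 0 (π / 2)) :
    ‖cos p.1 / sin p.1 * ((g (pt x p) - g (cos p.1 • x)) * (⟪w, p.2⟫ * ⟪v, p.2⟫ - ⟪w, v⟫))‖ ≤
      2 * L * ‖w‖ * ‖v‖ * exp (3 * ‖p.2‖) := by
  have hc := cos_pos' hp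
  have hs := sin_pos' hp
  have h1 : |g (pt x p) - g (cos p.1 • x)| ≤ L * (sin p.1 * ‖p.2‖) := by
    have := hg (pt x p) (cos p.1 • x)
    rwa [pt, add_sub_cancel_left, norm_smul, Real.norm_eq_abs, abs_of_pos hs] at this
  have ez : ‖p.2‖ ≤ exp ‖p.2‖ := by linarith [Real.add_one_le_exp ‖p.2‖]
  have ez1 : 1 ≤ exp ‖p.2‖ := Real.one_le_exp (norm_nonneg _)
  have h2 : |⟪w, p.2⟫ * ⟪v, p.2⟫ - ⟪w, v⟫| ≤ 2 * (‖w‖ * ‖v‖) * (exp ‖p.2‖ * exp ‖p.2‖) := by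
    refine (abs_sub _ _).trans ?_
    rw [abs_mul]
    have a1 := abs_real_inner_le_norm w v
    have a2 : |⟪w, p.2⟫| * |⟪v, p.2⟫| ≤ (‖w‖ * exp ‖p.2‖) * (‖v‖ * exp ‖p.2‖) :=
      mul_le_mul ((abs_real_inner_le_norm _ _).trans
          (mul_le_mul_of_nonneg_left ez (norm_nonneg _)))
        ((abs_real_inner_le_norm _ _).trans (mul_le_mul_of_nonneg_left ez (norm_nonneg _)))
        (abs_nonneg _) (by positivity)
    have a3 : ‖w‖ * ‖v‖ ≤ ‖w‖ * ‖v‖ * (exp ‖p.2‖ * exp ‖p.2‖) :=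
      le_mul_of_one_le_right (by positivity) (by nlinarith)
    nlinarith
  rw [Real.norm_eq_abs, abs_mul, abs_mul, abs_of_pos (div_pos hc hs)]
  calc cos p.1 / sin p.1 * (|g (pt x p) - g (cos p.1 • x)| * |⟪w, p.2⟫ * ⟪v, p.2⟫ - ⟪w, v⟫|)
      ≤ cos p.1 / sin p.1 * ((L * (sin p.1 * ‖p.2‖)) *
        (2 * (‖w‖ * ‖v‖) * (exp ‖p.2‖ * exp ‖p.2‖))) :=
        mul_le_mul_of_nonneg_left (mul_le_mul h1 h2 (abs_nonneg _) (by positivity))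
          (div_pos hc hs).le
    _ = cos p.1 * (‖p.2‖ * (2 * L * ‖w‖ * ‖v‖ * (exp ‖p.2‖ * exp ‖p.2‖))) := by
        field_simp
    _ ≤ 1 * (exp ‖p.2‖ * (2 * L * ‖w‖ * ‖v‖ * (exp ‖p.2‖ * exp ‖p.2‖))) := by
        refine mul_le_mul (Real.cos_le_one _) (mul_le_mul_of_nonneg_right ez (by positivity))
          (by positivity) zero_le_one
    _ = 2 * L * ‖w‖ * ‖v‖ * exp (3 * ‖p.2‖) := by
        rw [show 3 * ‖p.2‖ = ‖p.2‖ + ‖p.2‖ + ‖p.2‖ by ring, Real.exp_add, Real.exp_add]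
        ring

lemma hess_integrand_meas (gc : Continuous g) (x v w : EE d) :
    AEStronglyMeasurable (fun p : ℝ × EE d => cos p.1 / sin p.1 *
      ((g (pt x p) - g (cos p.1 • x)) * (⟪w, p.2⟫ * ⟪v, p.2⟫ - ⟪w, v⟫))) (mu d) := by
  have h1 : Continuous fun p : ℝ × EE d =>
      (g (pt x p) - g (cos p.1 • x)) * (⟪w, p.2⟫ * ⟪v, p.2⟫ - ⟪w, v⟫) := by
    have := gc.comp (cont_pt x)
    unfold pt
    fun_prop
  exact (Measurable.mul (by fun_prop) h1.measurable).aestronglyMeasurable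

lemma inner_solH' (hL : 0 ≤ L) (hg : ∀ x y, |g x - g y| ≤ L * ‖x - y‖) (x v w : EE d) :
    ⟪w, solH g x v⟫ = -∫ p : ℝ × EE d, cos p.1 / sin p.1 *
      ((g (pt x p) - g (cos p.1 • x)) * (⟪w, p.2⟫ * ⟪v, p.2⟫ - ⟪w, v⟫)) ∂(mu d) := by
  obtain ⟨i1, h1⟩ := inner_solH hL hg x v w
  rw [h1]
  have i2 := intgP (hess_integrand_meas (lipW hL hg).continuous x v w) _ _
    (hess_integrand_bound hL hg x v w)
  congr 1
  unfold mu at i1 i2 ⊢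
  rw [integral_prod _ i1, integral_prod _ i2]
  refine setIntegral_congr_fun measurableSet_Ioo fun θ hθ => ?_
  have hs := sin_pos' hθ
  have := ibp_slice hL hg (cos θ • x) hs (g (cos θ • x)) 0 w v
  simp only [zero_add] at this
  simp only [pt]
  rw [integral_const_mul, ← this, ← integral_const_mul]
  congr 1
  ext z
  field_simp

lemma solH_continuous (hL : 0 ≤ L) (hg : ∀ x y, |g x - g y| ≤ L * ‖x - y‖) :
    Continuous (solH g) := by
  have gc : Continuous g := (lipW hL hg).continuous
  rw [continuous_clm_apply]
  intro v
  have key : ∀ w, Continuous fun x => ⟪w, solH g x v⟫ := by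
    intro w
    simp_rw [inner_solH' hL hg _ v w]
    refine Continuous.neg ?_
    refine continuous_of_dominated (bound := fun p => 2 * L * ‖w‖ * ‖v‖ * exp (3 * ‖p.2‖))
      (fun x => hess_integrand_meas gc x v w) (fun x => ?_) ?_ ?_
    · filter_upwards [mu_mem d] with p hp using hess_integrand_bound hL hg x v w p hp
    · exact intgP (by fun_prop) (2 * L * ‖w‖ * ‖v‖) 3 fun p hp => by
        rw [Real.norm_eq_abs, abs_of_nonneg (by positivity)]
    · refine ae_of_all _ fun p => ?_
      unfold pt
      fun_prop
  have e : (fun x => solH g x v) = fun x =>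
      ∑ i, ⟪EuclideanSpace.basisFun (Fin d) ℝ i, solH g x v⟫ • EuclideanSpace.basisFun (Fin d) ℝ i := by
    ext1 x
    exact ((EuclideanSpace.basisFun (Fin d) ℝ).sum_repr' _).symm
  rw [e]
  exact continuous_finsetSum _ fun i _ => (key _).smul continuous_const

lemma gradient_sol (hL : 0 ≤ L) (hg : ∀ x y, |g x - g y| ≤ L * ‖x - y‖) :
    gradient (sol g) = solG g :=
  funext fun x => (sol_hasGradientAt hL hg x).gradient

lemma hess_sol (hL : 0 ≤ L) (hg : ∀ x y, |g x - g y| ≤ L * ‖x - y‖) (x : EE d) :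
    hess (sol g) x = solH g x := by
  unfold hess
  rw [gradient_sol hL hg]
  exact (solG_hasFDerivAt hL hg x).2.fderiv

lemma sol_contDiff (hL : 0 ≤ L) (hg : ∀ x y, |g x - g y| ≤ L * ‖x - y‖) :
    ContDiff ℝ 2 (sol g) := by
  have h1 : ContDiff ℝ 1 (solG g) :=
    contDiff_one_iff_hasFDerivAt.2 ⟨solH g, solH_continuous hL hg,
      fun x => (solG_hasFDerivAt hL hg x).2⟩
  rw [show (2 : WithTop ℕ∞) = ((1 : ℕ) : WithTop ℕ∞) + 1 by norm_num, contDiff_succ_iff_hasFDerivAt]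
  refine ⟨fun x => InnerProductSpace.toDual ℝ (EE d) (solG g x), ?_, fun x => ?_⟩
  · rw [Nat.cast_one]
    exact (InnerProductSpace.toDual ℝ (EE d)).toContinuousLinearEquiv.contDiff.comp h1
  · exact (sol_hasGradientAt hL hg x).hasFDerivAt

lemma hess_bound (hL : 0 ≤ L) (hg : ∀ x y, |g x - g y| ≤ L * ‖x - y‖) (x u₁ u₂ : EE d) :
    ⟪u₁, solH g x u₂⟫ ≤ (π / 2) * L * ‖u₁‖ * ‖u₂‖ := by
  obtain ⟨i1, h1⟩ := inner_solH hL hg x u₂ u₁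
  rw [h1]
  have i2 : Integrable (fun p : ℝ × EE d => L * ‖u₂‖ * |⟪u₁, p.2⟫|) (mu d) := by
    refine intgP (by fun_prop) (L * ‖u₂‖ * ‖u₁‖) 1 fun p hp => ?_
    rw [Real.norm_eq_abs, abs_of_nonneg (by positivity), one_mul, mul_assoc _ _ (exp _)]
    refine mul_le_mul_of_nonneg_left ?_ (by positivity)
    exact (abs_real_inner_le_norm _ _).trans (mul_le_mul_of_nonneg_left
      (by linarith [Real.add_one_le_exp ‖p.2‖]) (norm_nonneg _))
  have h2 : -∫ p, cos p.1 * fderiv ℝ g (pt x p) u₂ * ⟪u₁, p.2⟫ ∂(mu d) ≤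
      ∫ p : ℝ × EE d, L * ‖u₂‖ * |⟪u₁, p.2⟫| ∂(mu d) := by
    rw [← integral_neg]
    refine integral_mono i1.neg i2 fun p => ?_
    refine (neg_le_abs _).trans ?_
    rw [abs_mul, abs_mul]
    refine mul_le_mul_of_nonneg_right ?_ (abs_nonneg _)
    have := mul_le_mul (Real.abs_cos_le_one p.1) (D_le hL hg (pt x p) u₂) (abs_nonneg _) zero_le_one
    linarith
  refine h2.trans ?_
  unfold mu at i2 ⊢
  rw [integral_prod _ i2]
  simp only [integral_const_mul]
  rw [integral_const]
  have hvol : (volume.restrict (Set.Ioo 0 (π / 2))).real Set.univ = π / 2 := by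
    simp [Measure.real]
    positivity
  rw [hvol, smul_eq_mul]
  have hm := first_moment u₁
  have : L * ‖u₂‖ * ∫ z, |⟪u₁, z⟫| ∂(_root_.stdGaussian d) ≤ L * ‖u₂‖ * ‖u₁‖ :=
    mul_le_mul_of_nonneg_left hm (by positivity)
  nlinarith [Real.pi_pos]

/-- The interpolation. -/
lemma interp_deriv (hL : 0 ≤ L) (hg : ∀ x y, |g x - g y| ≤ L * ‖x - y‖) (u : EE d) :
    ∫ θ in (0:ℝ)..(π / 2), ∫ z, fderiv ℝ g (pt u (θ, z)) (cos θ • z - sin θ • u)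
        ∂(_root_.stdGaussian d) =
      ∫ z, g z ∂(_root_.stdGaussian d) - g u := by
  have gc : Continuous g := (lipW hL hg).continuous
  have hbnd : ∀ θ (z : EE d), ‖fderiv ℝ g (pt u (θ, z)) (cos θ • z - sin θ • u)‖ ≤
      L * (‖u‖ + ‖z‖) := by
    intro θ z
    refine (D_le hL hg _ _).trans (mul_le_mul_of_nonneg_left ?_ hL)
    refine (norm_sub_le _ _).trans ?_
    rw [norm_smul, norm_smul, add_comm]
    exact add_le_add (mul_le_of_le_one_left (norm_nonneg _) (Real.abs_sin_le_one θ))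
      (mul_le_of_le_one_left (norm_nonneg _) (Real.abs_cos_le_one θ))
  have bint : Integrable (fun z : EE d => L * (‖u‖ + ‖z‖)) (_root_.stdGaussian d) := by
    refine intg (by fun_prop) (L * (‖u‖ + 1)) 1 fun z => ?_
    rw [Real.norm_eq_abs, abs_of_nonneg (by positivity), one_mul, mul_assoc L]
    have := lin_le_exp (norm_nonneg u) zero_le_one (norm_nonneg z)
    rw [one_mul] at this
    exact mul_le_mul_of_nonneg_left this hL
  have ptmeas : Measurable fun q : ℝ × EE d =>
      fderiv ℝ g (pt u q) (cos q.1 • q.2 - sin q.1 • u) := by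
    have h1 := meas_D g u
    have h2 : Measurable fun q : ℝ × EE d => cos q.1 • q.2 - sin q.1 • u := by fun_prop
    have hc : Continuous fun q : (EE d →L[ℝ] ℝ) × EE d => q.1 q.2 := by fun_prop
    exact hc.measurable.comp (h1.prodMk h2)
  have gint : ∀ θ : ℝ, Integrable (fun z => g (pt u (θ, z))) (_root_.stdGaussian d) := fun θ => by
    refine intg ?_ ((|g 0| + L) * exp ‖u‖) 1 fun z => ?_
    · exact (gc.comp ((cont_pt u).comp (by fun_prop))).aestronglyMeasurable
    · rw [one_mul]; exact g_pt_growth hL hg u (θ, z)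
  have hder0 : ∀ (θ : ℝ) (z : EE d), HasDerivAt (fun θ => pt u (θ, z)) (cos θ • z - sin θ • u) θ := by
    intro θ z
    have := ((Real.hasDerivAt_cos θ).smul_const u).add ((Real.hasDerivAt_sin θ).smul_const z)
    refine this.congr_deriv ?_
    rw [neg_smul]; abel
  have plip : ∀ (z : EE d) (θ θ' : ℝ), ‖pt u (θ, z) - pt u (θ', z)‖ ≤ (‖u‖ + ‖z‖) * |θ - θ'| := by
    intro z θ θ'
    refine Convex.norm_image_sub_le_of_norm_hasDerivWithin_le (s := Set.univ)
      (f := fun θ => pt u (θ, z)) (fun t _ => (hder0 t z).hasDerivWithinAt) (fun t _ => ?_)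
      convex_univ trivial trivial
    refine (norm_sub_le _ _).trans ?_
    rw [norm_smul, norm_smul, add_comm]
    exact add_le_add (mul_le_of_le_one_left (norm_nonneg _) (Real.abs_sin_le_one _))
      (mul_le_of_le_one_left (norm_nonneg _) (Real.abs_cos_le_one _))
  set U : ℝ → ℝ := fun θ => ∫ z, g (pt u (θ, z)) ∂(_root_.stdGaussian d) with hU
  have hd : ∀ θ ∈ Set.Ioo 0 (π / 2), HasDerivAt U
      (∫ z, fderiv ℝ g (pt u (θ, z)) (cos θ • z - sin θ • u) ∂(_root_.stdGaussian d)) θ := by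
    intro θ hθ
    refine (hasDerivAt_integral_of_dominated_loc_of_lip (s := Set.univ)
      (bound := fun z => L * (‖u‖ + ‖z‖)) Filter.univ_mem
      (Filter.Eventually.of_forall fun θ => (gint θ).1) (gint θ) ?_ ?_ bint ?_).2
    · exact (ptmeas.comp (measurable_const.prodMk measurable_id)).aestronglyMeasurable
    · refine ae_of_all _ fun z => LipschitzOnWith.of_dist_le_mul fun t _ t' _ => ?_
      have hnn : 0 ≤ L * (‖u‖ + ‖z‖) := by positivity
      rw [Real.dist_eq, Real.dist_eq, Real.coe_nnabs, abs_of_nonneg hnn, mul_assoc]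
      exact (hg _ _).trans (mul_le_mul_of_nonneg_left (plip z t t') hL)
    · filter_upwards [ae_diff_slice hL hg (cos θ • u) (sin_pos' hθ)] with z hz
      exact HasFDerivAt.comp_hasDerivAt θ (f := fun θ => pt u (θ, z)) hz.hasFDerivAt (hder0 θ z)
  have hUc : Continuous U := by
    refine continuous_of_dominated (bound := fun z => ((|g 0| + L) * exp ‖u‖) * exp ‖z‖)
      (fun θ => (gint θ).1) (fun θ => ae_of_all _ fun z => g_pt_growth hL hg u (θ, z)) ?_
      (ae_of_all _ fun z => gc.comp ((cont_pt u).comp (by fun_prop)))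
    have := (integrable_exp_norm d 1).const_mul ((|g 0| + L) * exp ‖u‖)
    simpa using this
  have hInt : IntervalIntegrable (fun θ => ∫ z, fderiv ℝ g (pt u (θ, z)) (cos θ • z - sin θ • u)
      ∂(_root_.stdGaussian d)) volume 0 (π / 2) := by
    refine (intervalIntegrable_const (c := ∫ z : EE d, L * (‖u‖ + ‖z‖) ∂(_root_.stdGaussian d))).mono_fun
      ?_ ?_
    · exact (ptmeas.stronglyMeasurable.integral_prod_right' (ν := _root_.stdGaussian d)).aestronglyMeasurable
    · refine ae_of_all _ fun θ => ?_
      refine (norm_integral_le_of_norm_le bint (ae_of_all _ fun z => hbnd θ z)).trans ?_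
      exact le_abs_self _
  rw [intervalIntegral.integral_eq_sub_of_hasDerivAt_of_le (by positivity) hUc.continuousOn hd hInt]
  simp [hU, pt]

lemma stein_eq (hL : 0 ≤ L) (hg : ∀ x y, |g x - g y| ≤ L * ‖x - y‖) (u : EE d) :
    g u - ∫ z, g z ∂(_root_.stdGaussian d) = lap (sol g) u - ⟪u, gradient (sol g) u⟫ := by
  have hlap : lap (sol g) u = -∫ p, cos p.1 * fderiv ℝ g (pt u p) p.2 ∂(mu d) ∧
      Integrable (fun p : ℝ × EE d => cos p.1 * fderiv ℝ g (pt u p) p.2) (mu d) := by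
    have e : (fun p : ℝ × EE d => cos p.1 * fderiv ℝ g (pt u p) p.2) = fun p =>
        ∑ i, cos p.1 * fderiv ℝ g (pt u p) (EuclideanSpace.single i 1) *
          ⟪EuclideanSpace.single i (1:ℝ), p.2⟫ := by
      ext p
      have h := (EuclideanSpace.basisFun (Fin d) ℝ).sum_repr' p.2
      conv_lhs => rw [← h]
      rw [map_sum, Finset.mul_sum]
      refine Finset.sum_congr rfl fun i _ => ?_
      rw [map_smul, smul_eq_mul, EuclideanSpace.basisFun_apply]
      ring
    constructor
    · unfold lap
      rw [e, integral_finsetSum _ fun i _ => (inner_solH hL hg u _ _).1, ← Finset.sum_neg_distrib]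
      refine Finset.sum_congr rfl fun i _ => ?_
      rw [hess_sol hL hg, real_inner_comm, (inner_solH hL hg u _ _).2]
    · rw [e]
      exact integrable_finsetSum _ fun i _ => (inner_solH hL hg u _ _).1
  obtain ⟨hi, hd⟩ := sol_hasFDerivAt hL hg u
  have hgr : ⟪u, gradient (sol g) u⟫ = -∫ p, sin p.1 * fderiv ℝ g (pt u p) u ∂(mu d) := by
    have h1 := (sol_hasGradientAt hL hg u).hasFDerivAt.unique hd
    have h2 := congrArg (fun l => l u) h1
    simp only [InnerProductSpace.toDual_apply_apply, neg_apply] at h2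
    rw [ContinuousLinearMap.integral_apply hi] at h2
    rw [gradient_sol hL hg, real_inner_comm, h2]
    rfl
  have i1 : Integrable (fun p => sin p.1 * fderiv ℝ g (pt u p) u) (mu d) :=
    hi.apply_continuousLinearMap u
  rw [hlap.1, hgr]
  have h3 := integral_sub hlap.2 i1
  have h4 : ∫ p : ℝ × EE d, (cos p.1 * fderiv ℝ g (pt u p) p.2 - sin p.1 * fderiv ℝ g (pt u p) u)
      ∂(mu d) = ∫ z, g z ∂(_root_.stdGaussian d) - g u := by
    have i2 := hlap.2.sub i1
    rw [← interp_deriv hL hg u, intervalIntegral.integral_of_le (by positivity),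
      integral_Ioc_eq_integral_Ioo]
    unfold mu at i2 ⊢
    refine (integral_prod _ i2).trans ?_
    simp
  linarith

end main

end SteinAux

/-- Lemma 2.1, item (3): there is a universal constant C (independent of the dimension d,
of L and of g) such that for every L-Lipschitz g there is a C² solution f of Stein's
equation with ⟨∇²f(x), u₁u₂ᵀ⟩_HS = u₁ᵀ (∇²f(x)) u₂ ≤ C L ‖u₁‖ ‖u₂‖ for all x, u₁, u₂. -/
theorem stein_hessian_universal_bound :
    ∃ C : ℝ, 0 < C ∧ ∀ (d : ℕ), 1 ≤ d → ∀ (L : ℝ), 0 < L →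
      ∀ g : EuclideanSpace ℝ (Fin d) → ℝ, (∀ x y, |g x - g y| ≤ L * ‖x - y‖) →
      ∃ f : EuclideanSpace ℝ (Fin d) → ℝ, ContDiff ℝ 2 f ∧
        (∀ u, g u - ∫ z, g z ∂(stdGaussian d) = lap f u - ⟪u, gradient f u⟫) ∧
        (∀ (x u₁ u₂ : EuclideanSpace ℝ (Fin d)), ⟪u₁, hess f x u₂⟫ ≤ C * L * ‖u₁‖ * ‖u₂‖) := by
  refine ⟨Real.pi / 2, by positivity, fun d _ L hL g hg => ⟨SteinAux.sol g, ?_, ?_, ?_⟩⟩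
  · exact SteinAux.sol_contDiff hL.le hg
  · exact fun u => SteinAux.stein_eq hL.le hg u
  · intro x u₁ u₂
    rw [SteinAux.hess_sol hL.le hg]
    exact SteinAux.hess_bound hL.le hg x u₁ u₂
end
end
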